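/- arXiv:1107.3359 — 4 statements merged into one kernel-verified Lean document; each statement's English description precedes it below -/
import Mathlib

section
/- Let u, v ∈ S be monomials and let Z, W ⊆ {x_1,…,x_n} be subsets of the variables such that supp(u) ⊆ W and supp(v) ⊆ Z. Then uK[Z] ∩ vK[W] = lcm(u,v)K[Z ∩ W] (as K-subspaces of S). -/
open MvPolynomial

/-- The `K`-subspace `m·K[Z]` of `S = K[x_0,…,x_{n-1}]`, where `m` is the monomial with
exponent vector `a` and `Z` is a set of variables: the span of all monomials `m·w`
with `w` a monomial in the variables of `Z`. -/
noncomputable def StanleySpace (K : Type*) [Field K] {n : ℕ} (a : Fin n →₀ ℕ)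
    (Z : Finset (Fin n)) : Submodule K (MvPolynomial (Fin n) K) :=
  Submodule.span K
    {p | ∃ c : Fin n →₀ ℕ, c.support ⊆ Z ∧ p = monomial (a + c) (1 : K)}

/-- `I` is a monomial ideal, i.e. an ideal generated by monomials. -/
def IsMonomialIdeal {K : Type*} [Field K] {n : ℕ}
    (I : Ideal (MvPolynomial (Fin n) K)) : Prop :=
  ∃ G : Set (Fin n →₀ ℕ), I = Ideal.span ((fun a => monomial a (1 : K)) '' G)

/-- The `K`-subspace of `S` spanned by the monomials lying in `I` but not in `J`.
For monomial ideals `J ⊆ I` this is the canonical `K`-vector space representative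
of the `ℤⁿ`-graded module `I/J` inside `S`. -/
noncomputable def monomialSpan (K : Type*) [Field K] {n : ℕ}
    (I J : Ideal (MvPolynomial (Fin n) K)) : Submodule K (MvPolynomial (Fin n) K) :=
  Submodule.span K
    {p | ∃ a : Fin n →₀ ℕ, p = monomial a (1 : K) ∧
      monomial a (1 : K) ∈ I ∧ monomial a (1 : K) ∉ J}

/-- The family `(a i, Z i), i = 1,…,r` is a Stanley decomposition of the module `I/J`
(represented by the span of the monomials of `I \ J`): the Stanley spaces
`(a i)·K[Z i]` are independent and their (direct) sum is all of `I/J`. -/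
def IsStanleyDecomp (K : Type*) [Field K] {n r : ℕ}
    (I J : Ideal (MvPolynomial (Fin n) K))
    (a : Fin r → (Fin n →₀ ℕ)) (Z : Fin r → Finset (Fin n)) : Prop :=
  iSupIndep (fun i => StanleySpace K (a i) (Z i)) ∧
    (⨆ i, StanleySpace K (a i) (Z i)) = monomialSpan K I J

/-- The Stanley depth `sdepth_S (I/J)` of the module `I/J`, where `J ⊆ I ⊆ S` are
monomial ideals: the largest `d` such that there is a Stanley decomposition of `I/J`
all of whose Stanley spaces use at least `d` variables.  (As `ℕ∞`: the Stanley depth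
of the zero module, which admits the empty decomposition, is `⊤`.)
`sdepth K I ⊥` is `sdepth_S I` and `sdepth K ⊤ I` is `sdepth_S (S/I)`. -/
noncomputable def sdepth (K : Type*) [Field K] {n : ℕ}
    (I J : Ideal (MvPolynomial (Fin n) K)) : ℕ∞ :=
  sSup {d : ℕ∞ | ∃ (r : ℕ) (a : Fin r → (Fin n →₀ ℕ)) (Z : Fin r → Finset (Fin n)),
    IsStanleyDecomp K I J a Z ∧ ∀ i, d ≤ ((Z i).card : ℕ∞)}

/-- The depth `depth_S M` of an `S`-module `M` with respect to the maximal graded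
ideal `(x_0,…,x_{n-1})`: the supremum of the lengths of `M`-regular sequences
contained in that ideal. -/
noncomputable def gradedDepth (K : Type*) [Field K] (n : ℕ) (M : Type*)
    [AddCommGroup M] [Module (MvPolynomial (Fin n) K) M] : ℕ∞ :=
  sSup {k : ℕ∞ | ∃ rs : List (MvPolynomial (Fin n) K), (rs.length : ℕ∞) = k ∧
    (∀ x ∈ rs, x ∈ Ideal.span (Set.range (X : Fin n → MvPolynomial (Fin n) K))) ∧
    RingTheory.Sequence.IsRegular M rs}

/-- Extension of an ideal along an inclusion of polynomial rings induced by a map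
of variables (`IS`, for `f` injective). -/
noncomputable def extIdeal {K : Type*} [Field K] {m n : ℕ} (f : Fin m → Fin n)
    (I : Ideal (MvPolynomial (Fin m) K)) : Ideal (MvPolynomial (Fin n) K) :=
  Ideal.map (rename f : MvPolynomial (Fin m) K →ₐ[K] MvPolynomial (Fin n) K) I

/-- The inclusion of the variables of `S'' = K[x_{r+1},…,x_n]` into those of
`S = K[x_1,…,x_n]` (variables indexed from `0`). -/
def sndEmbed {n r : ℕ} (h : r ≤ n) : Fin (n - r) → Fin n :=
  fun i => ⟨r + i.1, by have := i.2; omega⟩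

/-- The inclusion of the variables of `S'' = K[x_s,…,x_n]` into those of
`S = K[x_1,…,x_n]` (variables indexed from `0`). -/
def midEmbed {n s : ℕ} (hs : 1 ≤ s) (hsn : s ≤ n) : Fin (n + 1 - s) → Fin n :=
  fun i => ⟨s - 1 + i.1, by have := i.2; omega⟩

theorem StanleySpace_eq_restrictSupport (K : Type*) [Field K] {n : ℕ} (a : Fin n →₀ ℕ)
    (Z : Finset (Fin n)) :
    StanleySpace K a Z = restrictSupport K {e | ∀ i, a i ≤ e i ∧ (i ∉ Z → e i = a i)} := by
  rw [StanleySpace, restrictSupport_eq_span]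
  congr 1
  ext p
  constructor
  · rintro ⟨c, hc, rfl⟩
    refine ⟨a + c, fun i => ⟨by simp, fun hi => ?_⟩, rfl⟩
    have : c i = 0 := Finsupp.notMem_support_iff.mp fun h => hi (hc h)
    simp [this]
  · rintro ⟨e, he, rfl⟩
    refine ⟨e - a, fun i hi => ?_, ?_⟩
    · by_contra h
      simp [(he i).2 h] at hi
    · rw [add_tsub_cancel_of_le fun i => (he i).1]

theorem restrictSupport_inf_restrictSupport {K σ : Type*} [Field K] (s t : Set (σ →₀ ℕ)) :
    restrictSupport K s ⊓ restrictSupport K t = restrictSupport K (s ∩ t) := by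
  ext p
  simp only [Submodule.mem_inf, mem_restrictSupport_iff, Set.subset_inter_iff]

/-- Let `u = x^a`, `v = x^b` be monomials in `S = K[x_1,…,x_n]` and
`Z, W` sets of variables with `supp u ⊆ W` and `supp v ⊆ Z`.  Then
`uK[Z] ⊓ vK[W] = lcm(u,v)·K[Z ∩ W]` (note that `lcm(u,v) = x^(a ⊔ b)`). -/
theorem stanleySpace_inf_of_support_subset {K : Type*} [Field K] {n : ℕ}
    (a b : Fin n →₀ ℕ) (Z W : Finset (Fin n))
    (hu : a.support ⊆ W) (hv : b.support ⊆ Z) :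
    StanleySpace K a Z ⊓ StanleySpace K b W = StanleySpace K (a ⊔ b) (Z ∩ W) := by
  simp only [StanleySpace_eq_restrictSupport, restrictSupport_inf_restrictSupport]
  congr 1
  ext e
  simp only [Set.mem_inter_iff, Set.mem_ofPred_eq, ← forall_and]
  refine forall_congr' fun i => ?_
  have ha : i ∉ W → a i = 0 := fun h => Finsupp.notMem_support_iff.mp fun h' => h (hu h')
  have hb : i ∉ Z → b i = 0 := fun h => Finsupp.notMem_support_iff.mp fun h' => h (hv h')
  rw [Finsupp.sup_apply, Finset.mem_inter]
  by_cases hZ : i ∈ Z <;> by_cases hW : i ∈ W <;> simp only [hZ, hW, not_true_eq_false,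
    not_false_eq_true, forall_true_left, false_imp_iff, and_true, and_false] at * <;> omega
end

section
/- Let I ⊂ S' = K[x_1,…,x_r] and J ⊂ S'' = K[x_{r+1},…,x_n] be monomial ideals, where 1 ≤ r < n, and let S = K[x_1,…,x_n]. Then sdepth_S(S/IS) ≥ sdepth_S(S/(IS ∩ JS)) ≥ min{ sdepth_S(S/IS), sdepth_{S''}(S''/J) + sdepth_{S'}(I) }. -/
open MvPolynomial

/-- The exponent vectors of the monomials of `StanleySpace K a Z`. -/
def stanleyBox {σ : Type*} (a : σ →₀ ℕ) (Z : Finset σ) : Set (σ →₀ ℕ) :=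
  {b | ∀ i, a i ≤ b i ∧ (i ∉ Z → b i = a i)}

/-- `A` is a finite disjoint union of boxes, each of which is free in at least `d` directions. -/
def HasBoxPartition {σ : Type*} (A : Set (σ →₀ ℕ)) (d : ℕ∞) : Prop :=
  ∃ (ι : Type) (_ : Finite ι) (a : ι → σ →₀ ℕ) (Z : ι → Finset σ),
    Pairwise (fun i j => Disjoint (stanleyBox (a i) (Z i)) (stanleyBox (a j) (Z j))) ∧
    (⋃ i, stanleyBox (a i) (Z i)) = A ∧ ∀ i, d ≤ ((Z i).card : ℕ∞)

section RestrictSupport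

variable {σ R : Type*} [CommSemiring R]

theorem restrictSupport_iUnion {ι : Sort*} (s : ι → Set (σ →₀ ℕ)) :
    restrictSupport R (⋃ i, s i) = ⨆ i, restrictSupport R (s i) := by
  simp only [restrictSupport_eq_span, Set.image_iUnion, Submodule.span_iUnion]

theorem disjoint_restrictSupport_iff [Nontrivial R] {s t : Set (σ →₀ ℕ)} :
    Disjoint (restrictSupport R s) (restrictSupport R t) ↔ Disjoint s t := by
  constructor
  · intro h
    rw [Set.disjoint_left]
    intro a ha hb
    have := Submodule.disjoint_def.1 h (monomial a 1)
      ((monomial_mem_restrictSupport R).2 (Or.inl ha)) ((monomial_mem_restrictSupport R).2 (Or.inl hb))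
    simp at this
  · intro h
    rw [Submodule.disjoint_def]
    intro x hx hy
    rw [mem_restrictSupport_iff] at hx hy
    rw [← support_eq_empty, Finset.eq_empty_iff_forall_notMem]
    exact fun a ha => Set.disjoint_left.1 h (hx ha) (hy ha)

theorem restrictSupport_injective [Nontrivial R] :
    Function.Injective (restrictSupport R : Set (σ →₀ ℕ) → Submodule R (MvPolynomial σ R)) := by
  intro s t h
  ext a
  have := SetLike.ext_iff.1 h (monomial a 1)
  simpa [monomial_mem_restrictSupport] using this

theorem iSupIndep_restrictSupport_iff [Nontrivial R] {ι : Type*} {s : ι → Set (σ →₀ ℕ)} :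
    iSupIndep (fun i => restrictSupport R (s i)) ↔
      Pairwise (fun i j => Disjoint (s i) (s j)) := by
  simp only [iSupIndep, ← restrictSupport_iUnion, disjoint_restrictSupport_iff,
    Set.disjoint_iUnion_right]
  exact ⟨fun h i j hij => h i j hij.symm, fun h i j hij => h hij.symm⟩

end RestrictSupport

section Boxes

variable {σ : Type*}

theorem HasBoxPartition.disjUnion {A B : Set (σ →₀ ℕ)} {d : ℕ∞} (hA : HasBoxPartition A d)
    (hB : HasBoxPartition B d) (hAB : Disjoint A B) : HasBoxPartition (A ∪ B) d := by
  obtain ⟨ι, _, a, Z, hd, rfl, hc⟩ := hA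
  obtain ⟨κ, _, b, W, hd', rfl, hc'⟩ := hB
  simp only [Set.disjoint_iUnion_left, Set.disjoint_iUnion_right] at hAB
  refine ⟨ι ⊕ κ, inferInstance, Sum.elim a b, Sum.elim Z W, ?_, ?_, ?_⟩
  · rintro (i | i) (j | j) hij
    · exact hd (by simpa using hij)
    · exact hAB j i
    · exact (hAB i j).symm
    · exact hd' (by simpa using hij)
  · simp [Set.iUnion_sum]
  · rintro (i | i)
    exacts [hc i, hc' i]

theorem HasBoxPartition.mono {A : Set (σ →₀ ℕ)} {d e : ℕ∞} (hA : HasBoxPartition A d)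
    (h : e ≤ d) : HasBoxPartition A e := by
  obtain ⟨ι, hι, a, Z, hd, hA, hc⟩ := hA
  exact ⟨ι, hι, a, Z, hd, hA, fun i => h.trans (hc i)⟩

theorem HasBoxPartition.preimage_add {A : Set (σ →₀ ℕ)} {d : ℕ∞} (hA : HasBoxPartition A d)
    (u : σ →₀ ℕ) : HasBoxPartition {a | a + u ∈ A} d := by
  obtain ⟨ι, _, a, Z, hd, rfl, hc⟩ := hA
  have key : ∀ i : {i : ι // ∀ k ∉ Z i, u k ≤ a i k}, ∀ b,
      b ∈ stanleyBox (a i - u) (Z i) ↔ b + u ∈ stanleyBox (a i) (Z i) := by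
    rintro ⟨i, hi⟩ b
    refine forall_congr' fun k => ?_
    have := hi k
    simp only [Finsupp.coe_tsub, Pi.sub_apply, Finsupp.coe_add, Pi.add_apply]
    by_cases hk : k ∈ Z i
    · simp [hk]
    · have := this hk
      simp only [hk, not_false_eq_true, forall_const]
      omega
  refine ⟨{i : ι // ∀ k ∉ Z i, u k ≤ a i k}, inferInstance, fun i => a i - u, fun i => Z i,
    ?_, ?_, fun i => hc i⟩
  · intro i j hij
    rw [Set.disjoint_left]
    intro b hb hb'
    rw [key] at hb hb'
    exact Set.disjoint_left.1 (hd fun h => hij (Subtype.ext h)) hb hb'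
  · ext b
    simp only [Set.mem_iUnion, key, Set.mem_ofPred_eq]
    constructor
    · rintro ⟨i, hi⟩
      exact ⟨i, hi⟩
    · rintro ⟨i, hi⟩
      refine ⟨⟨i, fun k hk => ?_⟩, hi⟩
      have := (hi k).2 hk
      simp only [Finsupp.coe_add, Pi.add_apply] at this
      omega

theorem HasBoxPartition.prod {τ υ : Type*} (e : σ ⊕ τ ≃ υ) {A : Set (σ →₀ ℕ)}
    {B : Set (τ →₀ ℕ)} {d d' : ℕ∞} (hA : HasBoxPartition A d) (hB : HasBoxPartition B d') :
    HasBoxPartition {c : υ →₀ ℕ |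
      c.comapDomain (e ∘ Sum.inl) (e.injective.comp Sum.inl_injective).injOn ∈ A ∧
      c.comapDomain (e ∘ Sum.inr) (e.injective.comp Sum.inr_injective).injOn ∈ B} (d + d') := by
  obtain ⟨ι, _, a, Z, hd, rfl, hc⟩ := hA
  obtain ⟨κ, _, b, W, hd', rfl, hc'⟩ := hB
  have key : ∀ i j (c : υ →₀ ℕ),
      c ∈ stanleyBox (((a i).sumElim (b j)).equivMapDomain e)
        (((Z i).disjSum (W j)).map e.toEmbedding) ↔
      c.comapDomain (e ∘ Sum.inl) (e.injective.comp Sum.inl_injective).injOn ∈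
        stanleyBox (a i) (Z i) ∧
      c.comapDomain (e ∘ Sum.inr) (e.injective.comp Sum.inr_injective).injOn ∈
        stanleyBox (b j) (W j) := by
    intro i j c
    simp only [stanleyBox, Set.mem_ofPred_eq]
    rw [← e.forall_congr_right]
    simp [Sum.forall]
  refine ⟨ι × κ, inferInstance, fun p => ((a p.1).sumElim (b p.2)).equivMapDomain e,
    fun p => ((Z p.1).disjSum (W p.2)).map e.toEmbedding, ?_, ?_, ?_⟩
  · rintro ⟨i, j⟩ ⟨i', j'⟩ hij
    rw [Set.disjoint_left]
    intro c hc hc'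
    rw [key] at hc hc'
    by_cases h : i = i'
    · have hj : j ≠ j' := fun hj => hij (by rw [h, hj])
      exact Set.disjoint_left.1 (hd' hj) hc.2 hc'.2
    · exact Set.disjoint_left.1 (hd h) hc.1 hc'.1
  · ext c
    simp [key]
  · rintro ⟨i, j⟩
    simp only [Finset.card_map, Finset.card_disjSum, Nat.cast_add]
    exact add_le_add (hc i) (hc' j)

/-- If membership in `A` only depends on the exponents truncated at `N`, then `A` is a finite
disjoint union of boxes. -/
theorem hasBoxPartition_of_truncation [Finite σ] {A : Set (σ →₀ ℕ)} (N : σ →₀ ℕ)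
    (hN : ∀ a, a ∈ A ↔ a ⊓ N ∈ A) : HasBoxPartition A 0 := by
  classical
  have := Fintype.ofFinite σ
  let e := Finite.equivFin {b : σ →₀ ℕ // b ∈ Set.Iic N ∩ A}
  have key : ∀ (b : {b : σ →₀ ℕ // b ∈ Set.Iic N ∩ A}) (c : σ →₀ ℕ),
      c ∈ stanleyBox b.1 {i | b.1 i = N i} ↔ c ⊓ N = b.1 := by
    rintro ⟨b, hb, -⟩ c
    rw [Finsupp.ext_iff]
    refine forall_congr' fun i => ?_
    have := hb i
    simp only [Finset.mem_filter, Finset.mem_univ, true_and, Finsupp.inf_apply]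
    omega
  refine ⟨_, inferInstance, fun i => (e.symm i).1, fun i => {k | (e.symm i).1 k = N k},
    ?_, ?_, fun _ => zero_le⟩
  · intro i j hij
    rw [Set.disjoint_left]
    intro c hc hc'
    rw [key] at hc hc'
    exact hij (e.symm.injective (Subtype.ext (hc.symm.trans hc')))
  · ext c
    simp only [Set.mem_iUnion, key]
    rw [hN c]
    constructor
    · rintro ⟨i, hi⟩
      rw [hi]
      exact (e.symm i).2.2
    · intro h
      have hle : c ⊓ N ≤ N := inf_le_right
      exact ⟨e ⟨c ⊓ N, hle, h⟩, by rw [e.symm_apply_apply]⟩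

theorem IsUpperSet.exists_truncation [Finite σ] {U : Set (σ →₀ ℕ)} (hU : IsUpperSet U) :
    ∃ N : σ →₀ ℕ, ∀ a, a ∈ U ↔ a ⊓ N ∈ U := by
  have hfin : {a | Minimal (· ∈ U) a}.Finite :=
    WellQuasiOrderedLE.finite_of_isAntichain (setOfPred_minimal_antichain _)
  obtain ⟨N, hN⟩ := hfin.bddAbove
  refine ⟨N, fun a => ⟨fun ha => ?_, fun ha => hU inf_le_left ha⟩⟩
  obtain ⟨m, hma, hm⟩ := exists_minimal_le_of_wellFoundedLT (· ∈ U) a ha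
  exact hU (le_inf hma (hN hm)) hm.1

theorem IsUpperSet.hasBoxPartition [Finite σ] {U : Set (σ →₀ ℕ)} (hU : IsUpperSet U) :
    HasBoxPartition U 0 :=
  let ⟨N, hN⟩ := hU.exists_truncation
  hasBoxPartition_of_truncation N hN

theorem IsUpperSet.hasBoxPartition_compl [Finite σ] {U : Set (σ →₀ ℕ)} (hU : IsUpperSet U) :
    HasBoxPartition Uᶜ 0 :=
  let ⟨N, hN⟩ := hU.exists_truncation
  hasBoxPartition_of_truncation N fun a => not_congr (hN a)

end Boxes

section StanleyDepth

variable {K : Type*} [Field K] {n : ℕ}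

theorem stanleySpace_eq_restrictSupport (a : Fin n →₀ ℕ) (Z : Finset (Fin n)) :
    StanleySpace K a Z = restrictSupport K (stanleyBox a Z) := by
  rw [restrictSupport_eq_span, StanleySpace]
  congr 1
  ext p
  constructor
  · rintro ⟨c, hc, rfl⟩
    refine ⟨a + c, fun i => ⟨by simp, fun hi => ?_⟩, rfl⟩
    have : c i = 0 := by
      by_contra h
      exact hi (hc (Finsupp.mem_support_iff.2 h))
    simp [this]
  · rintro ⟨b, hb, rfl⟩
    refine ⟨b - a, fun i hi => ?_, ?_⟩
    · by_contra h
      have := (hb i).2 h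
      simp [this] at hi
    · rw [add_tsub_cancel_of_le fun i => (hb i).1]

theorem monomialSpan_eq_restrictSupport (I J : Ideal (MvPolynomial (Fin n) K)) :
    monomialSpan K I J =
      restrictSupport K {a | monomial a (1 : K) ∈ I ∧ monomial a (1 : K) ∉ J} := by
  rw [restrictSupport_eq_span, monomialSpan]
  congr 1
  ext p
  constructor
  · rintro ⟨a, rfl, h⟩
    exact ⟨a, h, rfl⟩
  · rintro ⟨a, h, rfl⟩
    exact ⟨a, rfl, h⟩

theorem isStanleyDecomp_iff {r : ℕ} (I J : Ideal (MvPolynomial (Fin n) K))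
    (a : Fin r → (Fin n →₀ ℕ)) (Z : Fin r → Finset (Fin n)) :
    IsStanleyDecomp K I J a Z ↔
      Pairwise (fun i j => Disjoint (stanleyBox (a i) (Z i)) (stanleyBox (a j) (Z j))) ∧
      (⋃ i, stanleyBox (a i) (Z i)) =
        {a | monomial a (1 : K) ∈ I ∧ monomial a (1 : K) ∉ J} := by
  simp only [IsStanleyDecomp, stanleySpace_eq_restrictSupport, monomialSpan_eq_restrictSupport,
    iSupIndep_restrictSupport_iff, ← restrictSupport_iUnion, restrictSupport_injective.eq_iff]

theorem sdepth_eq_sSup (I J : Ideal (MvPolynomial (Fin n) K)) :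
    sdepth K I J = sSup {d | HasBoxPartition
      {a | monomial a (1 : K) ∈ I ∧ monomial a (1 : K) ∉ J} d} := by
  rw [sdepth]
  congr 1
  ext d
  simp only [isStanleyDecomp_iff, Set.mem_ofPred_eq]
  constructor
  · rintro ⟨r, a, Z, ⟨h₁, h₂⟩, h₃⟩
    exact ⟨Fin r, inferInstance, a, Z, h₁, h₂, h₃⟩
  · rintro ⟨ι, _, a, Z, h₁, h₂, h₃⟩
    let e := Finite.equivFin ι
    refine ⟨_, a ∘ e.symm, Z ∘ e.symm, ⟨fun i j hij => h₁ (e.symm.injective.ne hij), ?_⟩,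
      fun i => h₃ _⟩
    rw [← h₂]
    exact e.symm.surjective.iUnion_comp fun i => stanleyBox (a i) (Z i)

theorem hasBoxPartition_sSup {A : Set (Fin n →₀ ℕ)} (h : HasBoxPartition A 0) :
    HasBoxPartition A (sSup {d | HasBoxPartition A d}) := by
  have : Nonempty {d | HasBoxPartition A d} := ⟨⟨0, h⟩⟩
  rcases lt_or_eq_of_le (le_top : sSup {d | HasBoxPartition A d} ≤ ⊤) with hlt | heq
  · exact ENat.sSup_mem_of_nonempty_of_lt_top hlt
  · rw [heq]
    obtain ⟨d, ⟨ι, hι, a, Z, hd, hA, hc⟩, hnd⟩ :=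
      lt_sSup_iff.1 (heq ▸ ENat.natCast_lt_top n)
    refine ⟨ι, hι, a, Z, hd, hA, fun i => absurd (hnd.trans_le (hc i)) ?_⟩
    simpa using Finset.card_le_univ (Z i)

/-- The exponent vectors of the monomials of an ideal. -/
def monomialExponents (I : Ideal (MvPolynomial (Fin n) K)) : Set (Fin n →₀ ℕ) :=
  {a | monomial a (1 : K) ∈ I}

theorem isUpperSet_monomialExponents (I : Ideal (MvPolynomial (Fin n) K)) :
    IsUpperSet (monomialExponents I) := by
  intro a b hab ha
  have : monomial b (1 : K) = monomial (b - a) 1 * monomial a 1 := by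
    rw [monomial_mul, tsub_add_cancel_of_le hab, one_mul]
  rw [monomialExponents, Set.mem_ofPred_eq, this]
  exact I.mul_mem_left _ ha

theorem sdepth_top_eq (I : Ideal (MvPolynomial (Fin n) K)) :
    sdepth K ⊤ I = sSup {d | HasBoxPartition (monomialExponents I)ᶜ d} := by
  rw [sdepth_eq_sSup]
  simp [monomialExponents, Set.compl_ofPred]

theorem sdepth_bot_eq (I : Ideal (MvPolynomial (Fin n) K)) :
    sdepth K I ⊥ = sSup {d | HasBoxPartition (monomialExponents I) d} := by
  rw [sdepth_eq_sSup]
  simp [monomialExponents]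

theorem IsMonomialIdeal.nonempty_monomialExponents {I : Ideal (MvPolynomial (Fin n) K)}
    (hI : IsMonomialIdeal I) (h0 : I ≠ ⊥) : (monomialExponents I).Nonempty := by
  obtain ⟨G, rfl⟩ := hI
  rcases G.eq_empty_or_nonempty with rfl | ⟨g, hg⟩
  · simp at h0
  · exact ⟨g, Ideal.subset_span ⟨g, hg, rfl⟩⟩

theorem mem_monomialExponents_extIdeal {m : ℕ} {f : Fin m → Fin n} (hf : f.Injective)
    {I : Ideal (MvPolynomial (Fin m) K)} (hI : IsMonomialIdeal I) (a : Fin n →₀ ℕ) :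
    a ∈ monomialExponents (extIdeal f I) ↔
      a.comapDomain f hf.injOn ∈ monomialExponents I := by
  obtain ⟨G, rfl⟩ := hI
  have himg : extIdeal f (Ideal.span ((fun a => monomial a (1 : K)) '' G)) =
      Ideal.span ((fun a => monomial a (1 : K)) '' (Finsupp.mapDomain f '' G)) := by
    rw [extIdeal, Ideal.map_span, Set.image_image, Set.image_image]
    simp [rename_monomial]
  have hle (g : Fin m →₀ ℕ) : Finsupp.mapDomain f g ≤ a ↔ g ≤ a.comapDomain f hf.injOn := by
    constructor
    · intro h i
      simpa [Finsupp.mapDomain_apply hf] using h (f i)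
    · intro h i
      by_cases hi : i ∈ Set.range f
      · obtain ⟨j, rfl⟩ := hi
        simpa [Finsupp.mapDomain_apply hf] using h j
      · simp [Finsupp.mapDomain_of_notMem_range _ _ hi]
  simp [monomialExponents, himg, mem_ideal_span_monomial_image, hle]

end StanleyDepth

/-- For monomial ideals `I ⊂ S' = K[x_1,…,x_r]` and
`J ⊂ S'' = K[x_{r+1},…,x_n]` with `1 ≤ r < n`, one has
`sdepth_S(S/IS) ≥ sdepth_S(S/(IS ∩ JS)) ≥ min(sdepth_S(S/IS), sdepth_{S''}(S''/J) + sdepth_{S'}(I))`. -/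
theorem sdepth_quot_inf_bounds_disjoint_vars {K : Type*} [Field K] {n r : ℕ}
    (h1 : 1 ≤ r) (h2 : r < n)
    (I : Ideal (MvPolynomial (Fin r) K)) (J : Ideal (MvPolynomial (Fin (n - r)) K))
    (hmI : IsMonomialIdeal I) (hmJ : IsMonomialIdeal J)
    (hI0 : I ≠ ⊥) (hI1 : I ≠ ⊤) (hJ0 : J ≠ ⊥) (hJ1 : J ≠ ⊤) :
    sdepth K ⊤ (extIdeal (Fin.castLE h2.le) I) ≥
      sdepth K ⊤ (extIdeal (Fin.castLE h2.le) I ⊓ extIdeal (sndEmbed h2.le) J) ∧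
    sdepth K ⊤ (extIdeal (Fin.castLE h2.le) I ⊓ extIdeal (sndEmbed h2.le) J) ≥
      min (sdepth K ⊤ (extIdeal (Fin.castLE h2.le) I)) (sdepth K ⊤ J + sdepth K I ⊥) := by
  have hf : Function.Injective (Fin.castLE h2.le) := Fin.castLE_injective h2.le
  have hg : Function.Injective (sndEmbed h2.le) := fun i j h => by
    simpa [sndEmbed, Fin.ext_iff] using h
  have hfg : Function.Bijective (Sum.elim (Fin.castLE h2.le) (sndEmbed h2.le)) := by
    refine ⟨hf.sumElim hg fun i j h => ?_, fun i => ?_⟩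
    · have := i.2
      simp only [sndEmbed, Fin.ext_iff, Fin.val_castLE] at h
      omega
    · by_cases hi : i.1 < r
      · exact ⟨Sum.inl ⟨i, hi⟩, rfl⟩
      · refine ⟨Sum.inr ⟨i - r, by omega⟩, Fin.ext ?_⟩
        simp only [Sum.elim_inr, sndEmbed]
        omega
  let e := Equiv.ofBijective _ hfg
  set IS := extIdeal (Fin.castLE h2.le) I
  set JS := extIdeal (sndEmbed h2.le) J
  have hI (a) : a ∈ monomialExponents IS ↔ _ := mem_monomialExponents_extIdeal hf hmI a
  have hJ (a) : a ∈ monomialExponents JS ↔ _ := mem_monomialExponents_extIdeal hg hmJ a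
  have hinf : monomialExponents (IS ⊓ JS) = monomialExponents IS ∩ monomialExponents JS := rfl
  simp only [sdepth_top_eq, sdepth_bot_eq, hinf]
  constructor
  · obtain ⟨u, hu⟩ := hmJ.nonempty_monomialExponents hJ0
    refine sSup_le_sSup fun d hd => ?_
    change HasBoxPartition _ d
    convert hd.preimage_add (u.mapDomain (sndEmbed h2.le)) using 1
    ext a
    have h₁ : a + u.mapDomain (sndEmbed h2.le) ∈ monomialExponents JS := by
      rw [hJ]
      refine isUpperSet_monomialExponents J (fun i => ?_) hu
      simp [Finsupp.mapDomain_apply hg]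
    have h₂ : a + u.mapDomain (sndEmbed h2.le) ∈ monomialExponents IS ↔
        a ∈ monomialExponents IS := by
      rw [hI, hI]
      congr! 1
      ext i
      have : Fin.castLE h2.le i ∉ Set.range (sndEmbed h2.le) := by
        rintro ⟨j, hj⟩
        have := i.2
        simp only [sndEmbed, Fin.ext_iff, Fin.val_castLE] at hj
        omega
      simp [Finsupp.mapDomain_of_notMem_range _ _ this]
    simp [h₁, h₂]
  · refine le_sSup ?_
    change HasBoxPartition _ _
    have hS := hasBoxPartition_sSup (isUpperSet_monomialExponents IS).hasBoxPartition_compl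
    have hP := (hasBoxPartition_sSup (isUpperSet_monomialExponents I).hasBoxPartition).prod e
      (hasBoxPartition_sSup (isUpperSet_monomialExponents J).hasBoxPartition_compl)
    rw [add_comm] at hP
    have hdiff : {c : Fin n →₀ ℕ |
        c.comapDomain (e ∘ Sum.inl) (e.injective.comp Sum.inl_injective).injOn ∈
          monomialExponents I ∧
        c.comapDomain (e ∘ Sum.inr) (e.injective.comp Sum.inr_injective).injOn ∈
          (monomialExponents J)ᶜ} = monomialExponents IS \ monomialExponents JS := by
      ext c
      exact and_congr (hI c).symm (not_congr (hJ c).symm)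
    rw [hdiff] at hP
    convert (hS.mono (min_le_left _ _)).disjUnion (hP.mono (min_le_right _ _))
      (Set.disjoint_left.2 fun a ha hb => ha hb.1) using 1
    ext a
    simp only [Set.mem_compl_iff, Set.mem_inter_iff, Set.mem_union, Set.mem_sdiff]
    tauto
end

section
/- Let I ⊂ S' = K[x_1,…,x_r] and J ⊂ S'' = K[x_{r+1},…,x_n] be monomial ideals, where 1 ≤ r < n, and let S = K[x_1,…,x_n]. Then depth_S(S/(IS ∩ JS)) − 1 = depth_S(S/(IS + JS)) = depth_{S'}(S'/I) + depth_{S''}(S''/J). -/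
open MvPolynomial

section Depth

open CategoryTheory CategoryTheory.Abelian RingTheory.Sequence

universe u

variable {K : Type u} [Field K] {n : ℕ}

/-- The ideal of `K[x_0,…,x_{n-1}]` generated by the variables. -/
noncomputable abbrev varIdeal (K : Type u) [Field K] (n : ℕ) : Ideal (MvPolynomial (Fin n) K) :=
  Ideal.span (Set.range X)

lemma constantCoeff_eq_zero_of_mem_varIdeal {p : MvPolynomial (Fin n) K} (hp : p ∈ varIdeal K n) :
    constantCoeff p = 0 := by
  have : varIdeal K n ≤ RingHom.ker constantCoeff := by
    rw [Ideal.span_le]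
    rintro _ ⟨i, rfl⟩
    simp
  exact this hp

lemma varIdeal_ne_top : varIdeal K n ≠ ⊤ := by
  intro h
  simpa using constantCoeff_eq_zero_of_mem_varIdeal ((Ideal.eq_top_iff_one _).mp h)

/-- The vanishing of `Ext^i(K, M)` for `i < d`, where `K` is the residue field of `S` at the
ideal of the variables. -/
def ExtVanish (K : Type u) [Field K] (n : ℕ) (M : Type u) [AddCommGroup M]
    [Module (MvPolynomial (Fin n) K) M] (d : ℕ) : Prop :=
  ∀ i < d, Subsingleton (Ext (ModuleCat.of (MvPolynomial (Fin n) K)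
    (MvPolynomial (Fin n) K ⧸ varIdeal K n)) (ModuleCat.of _ M) i)

variable {M N P : Type u} [AddCommGroup M] [Module (MvPolynomial (Fin n) K) M]
  [AddCommGroup N] [Module (MvPolynomial (Fin n) K) N]
  [AddCommGroup P] [Module (MvPolynomial (Fin n) K) P]

lemma support_quotient_varIdeal :
    Module.support (MvPolynomial (Fin n) K) (MvPolynomial (Fin n) K ⧸ varIdeal K n) =
      PrimeSpectrum.zeroLocus (varIdeal K n) := by
  rw [Module.support_eq_zeroLocus, Ideal.annihilator_quotient]

lemma natCast_le_gradedDepth_iff [Module.Finite (MvPolynomial (Fin n) K) M]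
    (hM : varIdeal K n • (⊤ : Submodule (MvPolynomial (Fin n) K) M) < ⊤) {d : ℕ} :
    (d : ℕ∞) ≤ gradedDepth K n M ↔ ExtVanish K n M d := by
  constructor
  · intro h i hi
    have h' : (i : ℕ∞) < gradedDepth K n M := lt_of_lt_of_le (by exact_mod_cast hi) h
    obtain ⟨_, ⟨rs, rfl, hmem, hreg⟩, hlt⟩ := lt_sSup_iff.mp h'
    exact ModuleCat.subsingleton_ext_of_exists_isRegular (varIdeal K n) (ModuleCat.of _ _)
      support_quotient_varIdeal.le (ModuleCat.of _ M) hM rs hmem hreg i (by exact_mod_cast hlt)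
  · intro h
    obtain ⟨rs, hlen, hmem, hreg⟩ := ModuleCat.exists_isRegular_of_exists_subsingleton_ext
      (varIdeal K n) d (ModuleCat.of _ M) hM (ModuleCat.of _ _) support_quotient_varIdeal h
    exact le_sSup ⟨rs, by rw [hlen], hmem, hreg⟩

lemma exists_shortExact_of_exact {f : M →ₗ[MvPolynomial (Fin n) K] N}
    {g : N →ₗ[MvPolynomial (Fin n) K] P}
    (hf : Function.Injective f) (hfg : Function.Exact f g) (hg : Function.Surjective g) :
    ∃ S : ShortComplex (ModuleCat.{u} (MvPolynomial (Fin n) K)), S.ShortExact ∧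
      S.X₁ = ModuleCat.of _ M ∧ S.X₂ = ModuleCat.of _ N ∧ S.X₃ = ModuleCat.of _ P :=
  ⟨ModuleCat.shortComplexOfCompEqZero f g hfg.linearMap_comp_eq_zero,
    { exact := ModuleCat.shortComplex_exact _ hfg
      mono_f := by simpa [ModuleCat.mono_iff_injective] using! hf
      epi_g := by simpa [ModuleCat.epi_iff_surjective] using! hg }, rfl, rfl, rfl⟩

lemma subsingleton_ext_mid {S : ShortComplex (ModuleCat.{u} (MvPolynomial (Fin n) K))}
    (hS : S.ShortExact) (X : ModuleCat.{u} (MvPolynomial (Fin n) K)) (i : ℕ)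
    (h1 : Subsingleton (Ext X S.X₁ i)) (h3 : Subsingleton (Ext X S.X₃ i)) :
    Subsingleton (Ext X S.X₂ i) := by
  refine subsingleton_of_forall_eq 0 fun x ↦ ?_
  obtain ⟨y, rfl⟩ := Ext.covariant_sequence_exact₂ X hS x (Subsingleton.elim _ _)
  rw [Subsingleton.elim y 0, Ext.zero_comp]

lemma subsingleton_ext_right {S : ShortComplex (ModuleCat.{u} (MvPolynomial (Fin n) K))}
    (hS : S.ShortExact) (X : ModuleCat.{u} (MvPolynomial (Fin n) K)) (i : ℕ)
    (h2 : Subsingleton (Ext X S.X₂ i)) (h1 : Subsingleton (Ext X S.X₁ (i + 1))) :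
    Subsingleton (Ext X S.X₃ i) := by
  refine subsingleton_of_forall_eq 0 fun x ↦ ?_
  obtain ⟨y, rfl⟩ := Ext.covariant_sequence_exact₃ X hS x rfl (Subsingleton.elim _ _)
  rw [Subsingleton.elim y 0, Ext.zero_comp]

lemma subsingleton_ext_left {S : ShortComplex (ModuleCat.{u} (MvPolynomial (Fin n) K))}
    (hS : S.ShortExact) (X : ModuleCat.{u} (MvPolynomial (Fin n) K)) (i : ℕ)
    (h3 : Subsingleton (Ext X S.X₃ i)) (h2 : Subsingleton (Ext X S.X₂ (i + 1))) :
    Subsingleton (Ext X S.X₁ (i + 1)) := by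
  refine subsingleton_of_forall_eq 0 fun x ↦ ?_
  obtain ⟨y, rfl⟩ := Ext.covariant_sequence_exact₁ X hS x (Subsingleton.elim _ _) rfl
  rw [Subsingleton.elim y 0, Ext.zero_comp]

lemma subsingleton_ext_left_zero {S : ShortComplex (ModuleCat.{u} (MvPolynomial (Fin n) K))}
    (hS : S.ShortExact) (X : ModuleCat.{u} (MvPolynomial (Fin n) K))
    (h2 : Subsingleton (Ext X S.X₂ 0)) : Subsingleton (Ext X S.X₁ 0) :=
  have := hS.mono_f
  (Ext.postcomp_mk₀_injective_of_mono X S.f).subsingleton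

/-- Depth lemma for the right term of a short exact sequence `0 → M → N → P → 0`. -/
lemma ExtVanish.right_of_exact {f : M →ₗ[MvPolynomial (Fin n) K] N}
    {g : N →ₗ[MvPolynomial (Fin n) K] P}
    (hf : Function.Injective f) (hfg : Function.Exact f g) (hg : Function.Surjective g)
    {d : ℕ} (hN : ExtVanish K n N d) (hM : ExtVanish K n M (d + 1)) : ExtVanish K n P d := by
  obtain ⟨S, hS, e1, e2, e3⟩ := exists_shortExact_of_exact hf hfg hg
  rw [ExtVanish, ← e2] at hN
  rw [ExtVanish, ← e1] at hM
  rw [ExtVanish, ← e3]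
  exact fun i hi ↦ subsingleton_ext_right hS _ i (hN i hi) (hM (i + 1) (by omega))

/-- Depth lemma for the left term of a short exact sequence `0 → M → N → P → 0`. -/
lemma ExtVanish.left_of_exact {f : M →ₗ[MvPolynomial (Fin n) K] N}
    {g : N →ₗ[MvPolynomial (Fin n) K] P}
    (hf : Function.Injective f) (hfg : Function.Exact f g) (hg : Function.Surjective g)
    {d : ℕ} (hN : ExtVanish K n N (d + 1)) (hP : ExtVanish K n P d) :
    ExtVanish K n M (d + 1) := by
  obtain ⟨S, hS, e1, e2, e3⟩ := exists_shortExact_of_exact hf hfg hg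
  rw [ExtVanish, ← e2] at hN
  rw [ExtVanish, ← e3] at hP
  rw [ExtVanish, ← e1]
  rintro (_ | i) hi
  · exact subsingleton_ext_left_zero hS _ (hN 0 hi)
  · exact subsingleton_ext_left hS _ i (hP i (by omega)) (hN _ hi)

lemma ExtVanish.prod {d : ℕ} (hM : ExtVanish K n M d) (hN : ExtVanish K n N d) :
    ExtVanish K n (M × N) d := by
  obtain ⟨S, hS, e1, e2, e3⟩ := exists_shortExact_of_exact (K := K) (n := n) (M := M) (N := M × N) (P := N)
    (f := LinearMap.inl _ _ _) (g := LinearMap.snd _ _ _) LinearMap.inl_injective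
    Function.Exact.inl_snd LinearMap.snd_surjective
  rw [ExtVanish, ← e1] at hM
  rw [ExtVanish, ← e3] at hN
  rw [ExtVanish, ← e2]
  exact fun i hi ↦ subsingleton_ext_mid hS _ i (hM i hi) (hN i hi)

lemma ExtVanish.quotSMulTop {d : ℕ} {p : MvPolynomial (Fin n) K} (hp : IsSMulRegular M p)
    (h : ExtVanish K n M (d + 1)) : ExtVanish K n (QuotSMulTop p M) d :=
  fun i hi ↦ subsingleton_ext_right (IsSMulRegular.smulShortComplex_shortExact
    (M := ModuleCat.of _ M) hp) _ i (h i (by omega)) (h (i + 1) (by omega))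

end Depth
section IdealDepth

open RingTheory.Sequence
open scoped nonZeroDivisors Pointwise

universe u

variable {K : Type u} [Field K] {n : ℕ} {A : Ideal (MvPolynomial (Fin n) K)}
  {p : MvPolynomial (Fin n) K}

lemma varIdeal_smul_top_lt (hA : A ≤ varIdeal K n) :
    varIdeal K n • (⊤ : Submodule (MvPolynomial (Fin n) K) (MvPolynomial (Fin n) K ⧸ A)) < ⊤ := by
  refine lt_of_le_of_ne le_top fun h ↦ varIdeal_ne_top (K := K) (n := n) ?_
  have h' := congrArg (Submodule.comap A.mkQ) h
  rw [Submodule.comap_smul_top_of_surjective _ _ (Submodule.mkQ_surjective _)] at h'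
  simpa [hA] using h'

lemma nontrivial_quotient_of_le_varIdeal (hA : A ≤ varIdeal K n) :
    Nontrivial (MvPolynomial (Fin n) K ⧸ A) :=
  Ideal.Quotient.nontrivial_iff.mpr fun h ↦ varIdeal_ne_top (top_le_iff.mp (h.symm.le.trans hA))

lemma isSMulRegular_quotient_iff :
    IsSMulRegular (MvPolynomial (Fin n) K ⧸ A) p ↔ ∀ q, p * q ∈ A → q ∈ A :=
  isSMulRegular_quotient_iff_mem_of_smul_mem A p

/-- `(S/A)/p(S/A) ≃ S/(A + (p))`. -/
noncomputable def quotSMulTopEquivSup (A : Ideal (MvPolynomial (Fin n) K))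
    (p : MvPolynomial (Fin n) K) :
    QuotSMulTop p (MvPolynomial (Fin n) K ⧸ A) ≃ₗ[MvPolynomial (Fin n) K]
      MvPolynomial (Fin n) K ⧸ (A ⊔ Ideal.span {p}) :=
  (Submodule.quotEquivOfEq _ _ (by
    have hmap : Submodule.map (Submodule.mkQ A) (A ⊔ Ideal.span {p}) =
        p • (⊤ : Submodule (MvPolynomial (Fin n) K) (MvPolynomial (Fin n) K ⧸ A)) := by
      rw [Submodule.map_sup, Submodule.mkQ_map_self, bot_sup_eq,
        ← Submodule.ideal_span_singleton_smul, ← Submodule.range_mkQ A, LinearMap.range_eq_map,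
        ← Submodule.map_smul'']
      simp
    exact hmap.symm)).trans
  (Submodule.quotientQuotientEquivQuotient A (A ⊔ Ideal.span {p}) le_sup_left)

lemma gradedDepth_congr {M N : Type*} [AddCommGroup M] [Module (MvPolynomial (Fin n) K) M]
    [AddCommGroup N] [Module (MvPolynomial (Fin n) K) N] (e : M ≃ₗ[MvPolynomial (Fin n) K] N) :
    gradedDepth K n M = gradedDepth K n N := by
  simp only [gradedDepth, e.isRegular_congr]

lemma gradedDepth_quotient_eq_add_one (hA : A ≤ varIdeal K n) (hp : p ∈ varIdeal K n)
    (hreg : ∀ q, p * q ∈ A → q ∈ A) :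
    gradedDepth K n (MvPolynomial (Fin n) K ⧸ A) =
      gradedDepth K n (MvPolynomial (Fin n) K ⧸ (A ⊔ Ideal.span {p})) + 1 := by
  have hA' : A ⊔ Ideal.span {p} ≤ varIdeal K n :=
    sup_le hA ((Ideal.span_singleton_le_iff_mem _).mpr hp)
  have hreg' := isSMulRegular_quotient_iff.mpr hreg
  apply le_antisymm
  · refine ENat.forall_natCast_le_iff_le.mp fun d hd ↦ ?_
    cases d with
    | zero => simp
    | succ d =>
      rw [natCast_le_gradedDepth_iff (varIdeal_smul_top_lt hA)] at hd
      have hd' := hd.quotSMulTop hreg'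
      have hlt : varIdeal K n • (⊤ : Submodule (MvPolynomial (Fin n) K)
          (QuotSMulTop p (MvPolynomial (Fin n) K ⧸ A))) < ⊤ := by
        have := varIdeal_smul_top_lt hA'
        rw [← (Submodule.orderIsoMapComap (quotSMulTopEquivSup A p)).lt_iff_lt]
        simpa [Submodule.map_smul''] using this
      rw [← natCast_le_gradedDepth_iff hlt, gradedDepth_congr (quotSMulTopEquivSup A p)] at hd'
      push_cast
      gcongr
  · rw [← gradedDepth_congr (quotSMulTopEquivSup A p), gradedDepth, ENat.sSup_add]
    · refine iSup₂_le ?_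
      rintro _ ⟨rs, rfl, hmem, hrs⟩
      refine le_sSup ⟨p :: rs, by simp, ?_, (isRegular_cons_iff _ _ _).mpr ⟨hreg', hrs⟩⟩
      simpa using ⟨hp, hmem⟩
    · have := nontrivial_quotient_of_le_varIdeal hA'
      exact ⟨0, [], rfl, by simp,
        ((quotSMulTopEquivSup A p).isRegular_congr _).mpr (IsRegular.nil _ _)⟩

lemma exists_regular_or_socle (A : Ideal (MvPolynomial (Fin n) K)) :
    (∃ p ∈ varIdeal K n, ∀ q, p * q ∈ A → q ∈ A) ∨ ∃ u ∉ A, ∀ p ∈ varIdeal K n, p * u ∈ A := by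
  by_cases h : Subsingleton ((MvPolynomial (Fin n) K ⧸ varIdeal K n) →ₗ[MvPolynomial (Fin n) K]
    (MvPolynomial (Fin n) K ⧸ A))
  · obtain ⟨p, hp, hreg⟩ := IsSMulRegular.subsingleton_linearMap_iff.mp h
    rw [Ideal.annihilator_quotient] at hp
    exact Or.inl ⟨p, hp, isSMulRegular_quotient_iff.mp hreg⟩
  · right
    rw [not_subsingleton_iff_nontrivial] at h
    obtain ⟨f, hf⟩ := exists_ne (0 : (MvPolynomial (Fin n) K ⧸ varIdeal K n)
      →ₗ[MvPolynomial (Fin n) K] (MvPolynomial (Fin n) K ⧸ A))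
    obtain ⟨u, hu⟩ := Ideal.Quotient.mk_surjective (f 1)
    refine ⟨u, fun huA ↦ hf ?_, fun p hp ↦ ?_⟩
    · ext
      simpa [← hu] using Ideal.Quotient.eq_zero_iff_mem.mpr huA
    · rw [← Ideal.Quotient.eq_zero_iff_mem, map_mul, hu]
      have h1 : p • (1 : MvPolynomial (Fin n) K ⧸ varIdeal K n) = 0 :=
        (mul_one _).trans (Ideal.Quotient.eq_zero_iff_mem.mpr hp)
      exact (f.map_smul p 1).symm.trans ((congrArg f h1).trans f.map_zero)

lemma gradedDepth_eq_zero_of_socle {u : MvPolynomial (Fin n) K} (hu : u ∉ A)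
    (h : ∀ p ∈ varIdeal K n, p * u ∈ A) : gradedDepth K n (MvPolynomial (Fin n) K ⧸ A) = 0 := by
  rw [gradedDepth, ← bot_eq_zero, sSup_eq_bot]
  rintro _ ⟨_ | ⟨p, rs⟩, rfl, hmem, hrs⟩
  · simp
  · rw [isRegular_cons_iff] at hrs
    exact absurd (isSMulRegular_quotient_iff.mp hrs.1 u
      (h p (hmem p (by simp)))) hu

lemma exists_regular_of_gradedDepth_ne_zero
    (h : gradedDepth K n (MvPolynomial (Fin n) K ⧸ A) ≠ 0) :
    ∃ p ∈ varIdeal K n, ∀ q, p * q ∈ A → q ∈ A :=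
  (exists_regular_or_socle A).resolve_right fun ⟨_, hu, hu'⟩ ↦
    h (gradedDepth_eq_zero_of_socle hu hu')

lemma exists_socle_of_gradedDepth_eq_zero (hA : A ≤ varIdeal K n)
    (h : gradedDepth K n (MvPolynomial (Fin n) K ⧸ A) = 0) :
    ∃ u ∉ A, ∀ p ∈ varIdeal K n, p * u ∈ A :=
  (exists_regular_or_socle A).resolve_left fun ⟨_, hp, hreg⟩ ↦ by
    simp [gradedDepth_quotient_eq_add_one hA hp hreg] at h

lemma natCast_le_ringKrullDim (hA : A ≤ varIdeal K n) {d : ℕ}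
    (hd : (d : ℕ∞) ≤ gradedDepth K n (MvPolynomial (Fin n) K ⧸ A)) :
    (d : WithBot ℕ∞) ≤ ringKrullDim (MvPolynomial (Fin n) K ⧸ A) := by
  induction d generalizing A with
  | zero =>
    have := nontrivial_quotient_of_le_varIdeal hA
    exact ringKrullDim_nonneg_of_nontrivial
  | succ d ih =>
    obtain ⟨p, hp, hreg⟩ := exists_regular_of_gradedDepth_ne_zero (A := A) (by
      rintro h
      simp [h] at hd)
    rw [gradedDepth_quotient_eq_add_one hA hp hreg, Nat.cast_add, Nat.cast_one,
      ENat.add_le_add_iff_right ENat.one_ne_top] at hd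
    have hle := ih (sup_le hA ((Ideal.span_singleton_le_iff_mem _).mpr hp)) hd
    refine le_trans ?_ (ringKrullDim_succ_le_of_surjective
      (Ideal.Quotient.factor (le_sup_left : A ≤ A ⊔ Ideal.span {p}))
      (Ideal.Quotient.factor_surjective _) (r := Ideal.Quotient.mk A p) ?_ ?_)
    · push_cast
      gcongr
    · rw [mem_nonZeroDivisors_iff_right]
      intro q hq
      obtain ⟨q, rfl⟩ := Ideal.Quotient.mk_surjective q
      rw [← map_mul, Ideal.Quotient.eq_zero_iff_mem, mul_comm] at hq
      exact Ideal.Quotient.eq_zero_iff_mem.mpr (hreg q hq)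
    · rw [Ideal.Quotient.factor_mk, Ideal.Quotient.eq_zero_iff_mem]
      exact Ideal.mem_sup_right (Ideal.mem_span_singleton_self p)

lemma gradedDepth_ne_top {A : Ideal (MvPolynomial (Fin n) K)} (hA : A ≤ varIdeal K n) :
    gradedDepth K n (MvPolynomial (Fin n) K ⧸ A) ≠ ⊤ := by
  intro h
  have h1 := natCast_le_ringKrullDim hA (d := n + 1) (h ▸ le_top)
  have h2 := h1.trans (ringKrullDim_quotient_le A)
  rw [MvPolynomial.ringKrullDim_of_isNoetherianRing, ringKrullDim_eq_zero_of_field, zero_add] at h2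
  have h3 : ((n + 1 : ℕ) : WithBot ℕ∞) ≤ (n : ℕ) := h2.trans (by simp)
  norm_cast at h3
  omega

lemma gradedDepth_lt_of_ne_bot (hA : A ≤ varIdeal K n) (hA0 : A ≠ ⊥) :
    gradedDepth K n (MvPolynomial (Fin n) K ⧸ A) < n := by
  by_contra! h
  have h1 := natCast_le_ringKrullDim hA h
  obtain ⟨p, hp, hp0⟩ := Submodule.exists_mem_ne_zero_of_ne_bot hA0
  have h2 := ringKrullDim_succ_le_of_surjective (Ideal.Quotient.mk A) Ideal.Quotient.mk_surjective
    (mem_nonZeroDivisors_of_ne_zero hp0) (Ideal.Quotient.eq_zero_iff_mem.mpr hp)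
  rw [MvPolynomial.ringKrullDim_of_isNoetherianRing, ringKrullDim_eq_zero_of_field] at h2
  have h3 : ((n + 1 : ℕ) : WithBot ℕ∞) ≤ (n : ℕ) := by
    push_cast
    refine le_trans (by gcongr) (h2.trans (by simp))
  norm_cast at h3
  omega

lemma sub_card_le_gradedDepth (s : Finset (Fin n)) :
    ((n - s.card : ℕ) : ℕ∞) ≤ gradedDepth K n
      (MvPolynomial (Fin n) K ⧸ Ideal.span ((X : Fin n → MvPolynomial (Fin n) K) '' s)) := by
  induction hk : n - s.card generalizing s with
  | zero => simp
  | succ k ih =>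
    obtain ⟨i, hi⟩ : ∃ i, i ∉ s := by
      by_contra! h
      have := Finset.card_fin n
      rw [← Finset.eq_univ_iff_forall] at h
      simp [h] at hk
    have hreg : ∀ q : MvPolynomial (Fin n) K, X i * q ∈ Ideal.span (X '' (s : Set (Fin n))) →
        q ∈ Ideal.span (X '' (s : Set (Fin n))) := by
      intro q hq
      rw [mem_ideal_span_X_image] at hq ⊢
      intro m hm
      obtain ⟨j, hj, hne⟩ := hq (Finsupp.single i 1 + m) (by
        rw [mem_support_iff, coeff_X_mul]
        exact mem_support_iff.mp hm)
      refine ⟨j, hj, ?_⟩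
      have : i ≠ j := fun h ↦ hi (h ▸ hj)
      simpa [this] using hne
    rw [gradedDepth_quotient_eq_add_one (Ideal.span_mono (Set.image_subset_range _ _))
      (Ideal.subset_span ⟨i, rfl⟩) hreg, ← Ideal.span_union, Set.union_comm,
      Set.singleton_union, ← Set.image_insert_eq, ← Finset.coe_insert]
    push_cast
    gcongr
    exact ih _ (by rw [Finset.card_insert_of_notMem hi]; omega)

lemma natCast_le_gradedDepth_bot :
    (n : ℕ∞) ≤ gradedDepth K n (MvPolynomial (Fin n) K ⧸ (⊥ : Ideal (MvPolynomial (Fin n) K))) := by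
  have h := sub_card_le_gradedDepth (K := K) (∅ : Finset (Fin n))
  rwa [Finset.coe_empty, Set.image_empty, Ideal.span_empty, Finset.card_empty, Nat.sub_zero] at h

end IdealDepth

section Tensor

open scoped TensorProduct

variable {K : Type*} [Field K] {n r s : ℕ} {f : Fin r → Fin n} {g : Fin s → Fin n}

/-- `K[x] ⊗ K[y] ≃ K[x, y]`, where the variables of the right hand side are the disjoint union
of the images of `f` and `g`. -/
noncomputable def tensorEquivOfBijective (K : Type*) [Field K]
    (h : Function.Bijective (Sum.elim f g)) :
    MvPolynomial (Fin r) K ⊗[K] MvPolynomial (Fin s) K ≃ₐ[K] MvPolynomial (Fin n) K :=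
  AlgEquiv.ofAlgHom
    (Algebra.TensorProduct.lift (rename f) (rename g) fun _ _ ↦ Commute.all _ _)
    (aeval fun i ↦ Sum.elim (fun j ↦ X j ⊗ₜ 1) (fun k ↦ 1 ⊗ₜ X k)
      ((Equiv.ofBijective _ h).symm i))
    (by
      refine MvPolynomial.algHom_ext fun i ↦ ?_
      obtain ⟨i, rfl⟩ := (Equiv.ofBijective _ h).surjective i
      rw [AlgHom.comp_apply, aeval_X, Equiv.symm_apply_apply]
      cases i <;> simp)
    (by
      ext i
      · simpa using congrArg (Sum.elim (fun j ↦ X j ⊗ₜ 1) (fun k ↦ 1 ⊗ₜ X k))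
          ((Equiv.ofBijective _ h).symm_apply_apply (Sum.inl i))
      · simpa using congrArg (Sum.elim (fun j ↦ X j ⊗ₜ 1) (fun k ↦ 1 ⊗ₜ X k))
          ((Equiv.ofBijective _ h).symm_apply_apply (Sum.inr i)))

lemma exists_tensor_algHom (h : Function.Bijective (Sum.elim f g))
    (a : Ideal (MvPolynomial (Fin r) K)) (b : Ideal (MvPolynomial (Fin s) K)) :
    ∃ τ : MvPolynomial (Fin n) K →ₐ[K]
        (MvPolynomial (Fin r) K ⧸ a) ⊗[K] (MvPolynomial (Fin s) K ⧸ b),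
      (∀ p q, τ (rename f p * rename g q) = Ideal.Quotient.mk a p ⊗ₜ Ideal.Quotient.mk b q) ∧
      RingHom.ker τ = extIdeal f a ⊔ extIdeal g b := by
  have hE : ∀ p q, tensorEquivOfBijective K h (p ⊗ₜ q) = rename f p * rename g q :=
    fun p q ↦ by simp [tensorEquivOfBijective]
  refine ⟨(Algebra.TensorProduct.map (Ideal.Quotient.mkₐ K a) (Ideal.Quotient.mkₐ K b)).comp
    (tensorEquivOfBijective K h).symm, fun p q ↦ ?_, ?_⟩
  · simp [← hE]
  · have hker := Algebra.TensorProduct.map_ker (Ideal.Quotient.mkₐ K a) (Ideal.Quotient.mkₐ K b)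
      (Ideal.Quotient.mkₐ_surjective K a) (Ideal.Quotient.mkₐ_surjective K b)
    have ha : RingHom.ker (Ideal.Quotient.mkₐ K a) = a := Ideal.Quotient.mkₐ_ker K a
    have hb : RingHom.ker (Ideal.Quotient.mkₐ K b) = b := Ideal.Quotient.mkₐ_ker K b
    rw [ha, hb] at hker
    have h1 : RingHom.ker ((Algebra.TensorProduct.map (Ideal.Quotient.mkₐ K a)
        (Ideal.Quotient.mkₐ K b)).comp (tensorEquivOfBijective K h).symm.toAlgHom) =
        (RingHom.ker (Algebra.TensorProduct.map (Ideal.Quotient.mkₐ K a)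
        (Ideal.Quotient.mkₐ K b))).map (tensorEquivOfBijective K h).toAlgHom :=
      Ideal.comap_symm (I := RingHom.ker (Algebra.TensorProduct.map (Ideal.Quotient.mkₐ K a)
        (Ideal.Quotient.mkₐ K b))) (tensorEquivOfBijective K h).toRingEquiv
    have hf : (tensorEquivOfBijective K h).toAlgHom.comp
        Algebra.TensorProduct.includeLeft = rename f := AlgHom.ext fun p ↦ by simp [hE]
    have hg : (tensorEquivOfBijective K h).toAlgHom.comp
        Algebra.TensorProduct.includeRight = rename g := AlgHom.ext fun p ↦ by simp [hE]
    refine h1.trans ?_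
    rw [hker, Ideal.map_sup, extIdeal, extIdeal, ← hf, ← hg]
    congr 1 <;> exact Ideal.map_map _ _

lemma eq_zero_of_tmul_one_mul_eq_zero {R T : Type*} [CommRing R] [Algebra K R] [CommRing T]
    [Algebra K T] {x : R} (hx : ∀ y, x * y = 0 → y = 0) {t : R ⊗[K] T}
    (ht : x ⊗ₜ 1 * t = 0) : t = 0 := by
  have hinj : Function.Injective (LinearMap.mulLeft K x) :=
    (injective_iff_map_eq_zero _).mpr hx
  have hmul : LinearMap.rTensor T (LinearMap.mulLeft K x) = LinearMap.mulLeft K (x ⊗ₜ 1) :=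
    TensorProduct.ext' fun y z ↦ by simp
  refine Module.Flat.rTensor_preserves_injective_linearMap (M := T) _ hinj ?_
  rw [hmul, map_zero, LinearMap.mulLeft_apply, ht]

lemma mem_sup_of_rename_mul_mem (h : Function.Bijective (Sum.elim f g))
    {a : Ideal (MvPolynomial (Fin r) K)} (b : Ideal (MvPolynomial (Fin s) K))
    {p : MvPolynomial (Fin r) K} (hp : ∀ q, p * q ∈ a → q ∈ a)
    {q : MvPolynomial (Fin n) K} (hq : rename f p * q ∈ extIdeal f a ⊔ extIdeal g b) :
    q ∈ extIdeal f a ⊔ extIdeal g b := by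
  obtain ⟨τ, hτ, hker⟩ := exists_tensor_algHom h a b
  rw [← hker, RingHom.mem_ker] at hq ⊢
  have h1 := hτ p 1
  rw [map_one, mul_one, map_one] at h1
  rw [map_mul, h1] at hq
  refine eq_zero_of_tmul_one_mul_eq_zero (fun x hx ↦ ?_) hq
  obtain ⟨x, rfl⟩ := Ideal.Quotient.mk_surjective x
  rw [← map_mul, Ideal.Quotient.eq_zero_iff_mem] at hx
  exact Ideal.Quotient.eq_zero_iff_mem.mpr (hp _ hx)

lemma rename_mul_rename_notMem_sup (h : Function.Bijective (Sum.elim f g))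
    {a : Ideal (MvPolynomial (Fin r) K)} {b : Ideal (MvPolynomial (Fin s) K)}
    {u : MvPolynomial (Fin r) K} {v : MvPolynomial (Fin s) K} (hu : u ∉ a) (hv : v ∉ b) :
    rename f u * rename g v ∉ extIdeal f a ⊔ extIdeal g b := by
  obtain ⟨τ, hτ, hker⟩ := exists_tensor_algHom h a b
  rw [← hker, RingHom.mem_ker, hτ]
  rw [← Ideal.Quotient.eq_zero_iff_mem] at hu hv
  have hinj : Function.Injective
      (LinearMap.toSpanSingleton K (MvPolynomial (Fin r) K ⧸ a) (Ideal.Quotient.mk a u)) :=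
    LinearMap.ker_eq_bot.mp (LinearMap.ker_toSpanSingleton K hu)
  have hinj' := Module.Flat.rTensor_preserves_injective_linearMap
    (M := MvPolynomial (Fin s) K ⧸ b) _ hinj
  intro h0
  refine hv ((TensorProduct.lid K _).symm.injective (hinj' ?_))
  simpa using h0

end Tensor

section DisjointVariables

universe u

variable {K : Type u} [Field K] {n r s : ℕ} {f : Fin r → Fin n} {g : Fin s → Fin n}

lemma bijective_elim_swap (h : Function.Bijective (Sum.elim f g)) :
    Function.Bijective (Sum.elim g f) := by
  rw [← Sum.elim_swap]
  exact h.comp (Equiv.sumComm _ _).bijective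

lemma rename_mem_varIdeal {p : MvPolynomial (Fin r) K} (hp : p ∈ varIdeal K r) :
    rename f p ∈ varIdeal K n := by
  have hle : varIdeal K r ≤ (varIdeal K n).comap (rename f : _ →ₐ[K] _) := by
    refine Ideal.span_le.mpr ?_
    rintro _ ⟨i, rfl⟩
    simpa using Ideal.subset_span (Set.mem_range_self (f i))
  exact hle hp

lemma extIdeal_le_varIdeal {a : Ideal (MvPolynomial (Fin r) K)} (ha : a ≤ varIdeal K r) :
    extIdeal f a ≤ varIdeal K n :=
  Ideal.map_le_iff_le_comap.mpr fun _ hp ↦ rename_mem_varIdeal (ha hp)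

lemma extIdeal_sup_span_singleton (a : Ideal (MvPolynomial (Fin r) K))
    (p : MvPolynomial (Fin r) K) :
    extIdeal f (a ⊔ Ideal.span {p}) = extIdeal f a ⊔ Ideal.span {rename f p} := by
  rw [extIdeal, Ideal.map_sup, Ideal.map_span, Set.image_singleton]
  rfl

lemma mul_rename_mem_of_socle (h : Function.Bijective (Sum.elim f g))
    {a : Ideal (MvPolynomial (Fin r) K)} {b : Ideal (MvPolynomial (Fin s) K)}
    {u : MvPolynomial (Fin r) K} {v : MvPolynomial (Fin s) K}
    (hu : ∀ p ∈ varIdeal K r, p * u ∈ a) (hv : ∀ p ∈ varIdeal K s, p * v ∈ b)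
    {p : MvPolynomial (Fin n) K} (hp : p ∈ varIdeal K n) :
    p * (rename f u * rename g v) ∈ extIdeal f a ⊔ extIdeal g b := by
  induction hp using Submodule.span_induction with
  | zero => simp
  | add x y _ _ hx hy =>
    rw [add_mul]
    exact add_mem hx hy
  | smul c x _ hx =>
    rw [smul_eq_mul, mul_assoc]
    exact Ideal.mul_mem_left _ _ hx
  | mem x hx =>
    obtain ⟨i, rfl⟩ := hx
    obtain ⟨i | i, rfl⟩ := h.surjective i
    · have := Ideal.mem_map_of_mem (rename f : _ →ₐ[K] _)
        (hu (X i) (Ideal.subset_span ⟨i, rfl⟩))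
      rw [map_mul, rename_X] at this
      rw [Sum.elim_inl, ← mul_assoc]
      exact Ideal.mem_sup_left (Ideal.mul_mem_right _ _ this)
    · have := Ideal.mem_map_of_mem (rename g : _ →ₐ[K] _)
        (hv (X i) (Ideal.subset_span ⟨i, rfl⟩))
      rw [map_mul, rename_X] at this
      rw [Sum.elim_inr, mul_left_comm]
      exact Ideal.mem_sup_right (Ideal.mul_mem_left _ _ this)

lemma gradedDepth_quotient_extIdeal_sup_add_one (h : Function.Bijective (Sum.elim f g))
    {a : Ideal (MvPolynomial (Fin r) K)} {b : Ideal (MvPolynomial (Fin s) K)}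
    (ha : a ≤ varIdeal K r) (hb : b ≤ varIdeal K s) {p : MvPolynomial (Fin r) K}
    (hp : p ∈ varIdeal K r) (hreg : ∀ q, p * q ∈ a → q ∈ a) :
    gradedDepth K n (MvPolynomial (Fin n) K ⧸ (extIdeal f a ⊔ extIdeal g b)) =
      gradedDepth K n (MvPolynomial (Fin n) K ⧸
        (extIdeal f (a ⊔ Ideal.span {p}) ⊔ extIdeal g b)) + 1 := by
  rw [gradedDepth_quotient_eq_add_one
    (sup_le (extIdeal_le_varIdeal ha) (extIdeal_le_varIdeal hb)) (rename_mem_varIdeal hp)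
    fun q ↦ mem_sup_of_rename_mul_mem h b hreg, extIdeal_sup_span_singleton, sup_right_comm]

/-- `depth (S'/a ⊗ S''/b) = depth S'/a + depth S''/b`. -/
lemma gradedDepth_quotient_extIdeal_sup (h : Function.Bijective (Sum.elim f g))
    {a : Ideal (MvPolynomial (Fin r) K)} {b : Ideal (MvPolynomial (Fin s) K)}
    (ha : a ≤ varIdeal K r) (hb : b ≤ varIdeal K s) :
    gradedDepth K n (MvPolynomial (Fin n) K ⧸ (extIdeal f a ⊔ extIdeal g b)) =
      gradedDepth K r (MvPolynomial (Fin r) K ⧸ a) +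
        gradedDepth K s (MvPolynomial (Fin s) K ⧸ b) := by
  have h' := bijective_elim_swap h
  obtain ⟨d, hd⟩ := ENat.ne_top_iff_exists.mp (gradedDepth_ne_top ha)
  obtain ⟨e, he⟩ := ENat.ne_top_iff_exists.mp (gradedDepth_ne_top hb)
  induction d generalizing a with
  | succ d ih =>
    obtain ⟨p, hp, hreg⟩ := exists_regular_of_gradedDepth_ne_zero (A := a) (by simp [← hd])
    have hD := gradedDepth_quotient_eq_add_one ha hp hreg
    rw [gradedDepth_quotient_extIdeal_sup_add_one h ha hb hp hreg,
      ih (sup_le ha ((Ideal.span_singleton_le_iff_mem _).mpr hp)) ?_, hD, add_right_comm]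
    rw [← hd] at hD
    exact ENat.add_left_injective_of_ne_top ENat.one_ne_top (by exact_mod_cast hD)
  | zero =>
    induction e generalizing b with
    | succ e ih =>
      obtain ⟨p, hp, hreg⟩ := exists_regular_of_gradedDepth_ne_zero (A := b) (by simp [← he])
      have hD := gradedDepth_quotient_eq_add_one hb hp hreg
      rw [sup_comm, gradedDepth_quotient_extIdeal_sup_add_one h' hb ha hp hreg, sup_comm,
        ih (sup_le hb ((Ideal.span_singleton_le_iff_mem _).mpr hp)) ?_, hD, add_assoc]
      rw [← he] at hD
      exact ENat.add_left_injective_of_ne_top ENat.one_ne_top (by exact_mod_cast hD)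
    | zero =>
      obtain ⟨u, hu, hu'⟩ := exists_socle_of_gradedDepth_eq_zero ha hd.symm
      obtain ⟨v, hv, hv'⟩ := exists_socle_of_gradedDepth_eq_zero hb he.symm
      rw [← hd, ← he, gradedDepth_eq_zero_of_socle (rename_mul_rename_notMem_sup h hu hv)
        fun p hp ↦ mul_rename_mem_of_socle h hu' hv' hp]
      simp

lemma extIdeal_bot : extIdeal f (⊥ : Ideal (MvPolynomial (Fin r) K)) = ⊥ := Ideal.map_bot

lemma gradedDepth_add_lt_left (h : Function.Bijective (Sum.elim f g))
    {a : Ideal (MvPolynomial (Fin r) K)} {b : Ideal (MvPolynomial (Fin s) K)}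
    (ha : a ≤ varIdeal K r) (hb : b ≤ varIdeal K s) (hb0 : b ≠ ⊥) :
    gradedDepth K n (MvPolynomial (Fin n) K ⧸ (extIdeal f a ⊔ extIdeal g b)) <
      gradedDepth K n (MvPolynomial (Fin n) K ⧸ extIdeal f a) := by
  have h1 := gradedDepth_quotient_extIdeal_sup h ha (bot_le : ⊥ ≤ varIdeal K s)
  rw [extIdeal_bot, sup_bot_eq] at h1
  rw [h1, gradedDepth_quotient_extIdeal_sup h ha hb]
  exact (ENat.add_lt_add_iff_left (gradedDepth_ne_top ha)).mpr
    ((gradedDepth_lt_of_ne_bot hb hb0).trans_le natCast_le_gradedDepth_bot)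

/-- If `S/(A + B)` has smaller depth than `S/A` and `S/B`, then
`depth S/(A ∩ B) = depth S/(A + B) + 1`. -/
lemma gradedDepth_quotient_inf {A B : Ideal (MvPolynomial (Fin n) K)}
    (hA : A ≤ varIdeal K n) (hB : B ≤ varIdeal K n)
    (hAlt : gradedDepth K n (MvPolynomial (Fin n) K ⧸ (A ⊔ B)) <
      gradedDepth K n (MvPolynomial (Fin n) K ⧸ A))
    (hBlt : gradedDepth K n (MvPolynomial (Fin n) K ⧸ (A ⊔ B)) <
      gradedDepth K n (MvPolynomial (Fin n) K ⧸ B)) :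
    gradedDepth K n (MvPolynomial (Fin n) K ⧸ (A ⊓ B)) =
      gradedDepth K n (MvPolynomial (Fin n) K ⧸ (A ⊔ B)) + 1 := by
  have hinf : A ⊓ B ≤ varIdeal K n := inf_le_left.trans hA
  have hsup : A ⊔ B ≤ varIdeal K n := sup_le hA hB
  obtain ⟨d, hd⟩ := ENat.ne_top_iff_exists.mp (gradedDepth_ne_top hsup)
  have hA' : ExtVanish K n (MvPolynomial (Fin n) K ⧸ A) (d + 1) := by
    rw [← natCast_le_gradedDepth_iff (varIdeal_smul_top_lt hA)]
    rw [← hd] at hAlt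
    exact_mod_cast Order.add_one_le_of_lt hAlt
  have hB' : ExtVanish K n (MvPolynomial (Fin n) K ⧸ B) (d + 1) := by
    rw [← natCast_le_gradedDepth_iff (varIdeal_smul_top_lt hB)]
    rw [← hd] at hBlt
    exact_mod_cast Order.add_one_le_of_lt hBlt
  let φ : (MvPolynomial (Fin n) K ⧸ (A ⊓ B)) →ₗ[MvPolynomial (Fin n) K]
      (MvPolynomial (Fin n) K ⧸ A) × (MvPolynomial (Fin n) K ⧸ B) :=
    (Submodule.factor inf_le_left).prod (Submodule.factor inf_le_right)
  let ψ : (MvPolynomial (Fin n) K ⧸ A) × (MvPolynomial (Fin n) K ⧸ B) →ₗ[MvPolynomial (Fin n) K]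
      (MvPolynomial (Fin n) K ⧸ (A ⊔ B)) :=
    (Submodule.factor le_sup_left).coprod (-Submodule.factor le_sup_right)
  have hφ : Function.Injective φ := by
    rw [injective_iff_map_eq_zero]
    intro x hx
    obtain ⟨x, rfl⟩ := Submodule.mkQ_surjective _ x
    refine (Submodule.Quotient.mk_eq_zero _).mpr ?_
    simpa [φ, Ideal.Quotient.eq_zero_iff_mem] using hx
  have hψ : Function.Surjective ψ := fun y ↦ by
    obtain ⟨y, rfl⟩ := Submodule.mkQ_surjective _ y
    exact ⟨(Submodule.Quotient.mk y, 0), by simp [ψ]⟩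
  have hex : Function.Exact φ ψ := by
    rintro ⟨x, y⟩
    obtain ⟨x, rfl⟩ := Submodule.mkQ_surjective _ x
    obtain ⟨y, rfl⟩ := Submodule.mkQ_surjective _ y
    constructor
    · intro hxy
      have hmem : x - y ∈ A ⊔ B := by
        rw [← Submodule.Quotient.mk_eq_zero, Submodule.Quotient.mk_sub]
        simpa [ψ, sub_eq_add_neg] using hxy
      obtain ⟨u, hu, v, hv, huv⟩ := Submodule.mem_sup.mp hmem
      refine ⟨Submodule.Quotient.mk (x - u), Prod.ext ?_ ?_⟩
      · refine (Submodule.Quotient.eq A).mpr ?_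
        simpa using hu
      · refine (Submodule.Quotient.eq B).mpr ?_
        change x - u - y ∈ B
        convert hv using 1
        linear_combination -huv
    · rintro ⟨z, hz⟩
      obtain ⟨z, rfl⟩ := Submodule.mkQ_surjective _ z
      rw [← hz]
      simp [φ, ψ]
  have hN := hA'.prod hB'
  have hC : ExtVanish K n (MvPolynomial (Fin n) K ⧸ (A ⊔ B)) d := by
    rw [← natCast_le_gradedDepth_iff (varIdeal_smul_top_lt hsup), hd]
  apply le_antisymm
  · by_contra! hlt
    refine (Order.add_one_le_of_lt hlt).not_gt ?_
    rw [← not_le, ← hd]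
    intro hle
    have hle' : ((d + 1 + 1 : ℕ) : ℕ∞) ≤
        gradedDepth K n (MvPolynomial (Fin n) K ⧸ (A ⊓ B)) := by exact_mod_cast hle
    rw [natCast_le_gradedDepth_iff (varIdeal_smul_top_lt hinf)] at hle'
    have := hN.right_of_exact hφ hex hψ hle'
    rw [← natCast_le_gradedDepth_iff (varIdeal_smul_top_lt hsup), ← hd] at this
    norm_cast at this
    omega
  · rw [← hd]
    have := hN.left_of_exact hφ hex hψ hC
    rw [← natCast_le_gradedDepth_iff (varIdeal_smul_top_lt hinf)] at this
    exact_mod_cast this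

lemma IsMonomialIdeal.le_varIdeal {I : Ideal (MvPolynomial (Fin n) K)} (hI : IsMonomialIdeal I)
    (hI1 : I ≠ ⊤) : I ≤ varIdeal K n := by
  obtain ⟨G, rfl⟩ := hI
  rw [Ideal.span_le]
  rintro _ ⟨a, ha, rfl⟩
  obtain ⟨i, hi⟩ : ∃ i, a i ≠ 0 := by
    by_contra! h
    obtain rfl : a = 0 := Finsupp.ext h
    exact hI1 ((Ideal.eq_top_iff_one _).mpr (Ideal.subset_span ⟨0, ha, rfl⟩))
  rw [SetLike.mem_coe, varIdeal, ← Set.image_univ, mem_ideal_span_X_image]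
  intro m hm
  have := Finset.mem_singleton.mp (support_monomial_subset hm)
  exact ⟨i, Set.mem_univ _, this ▸ hi⟩

lemma bijective_elim_castLE_sndEmbed (h : r ≤ n) :
    Function.Bijective (Sum.elim (Fin.castLE h) (sndEmbed h)) := by
  refine (Fintype.bijective_iff_injective_and_card _).mpr ⟨?_, by simp [h]⟩
  rintro (i | i) (j | j) hij <;> have := congrArg Fin.val hij <;>
    simp [sndEmbed] at this ⊢ <;> omega

end DisjointVariables

/-- For monomial ideals `I ⊂ S' = K[x_1,…,x_r]` and
`J ⊂ S'' = K[x_{r+1},…,x_n]` with `1 ≤ r < n`, one has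
`depth_S(S/(IS ∩ JS)) - 1 = depth_S(S/(IS + JS)) = depth_{S'}(S'/I) + depth_{S''}(S''/J)`. -/
theorem depth_quot_disjoint_vars {K : Type*} [Field K] {n r : ℕ}
    (h1 : 1 ≤ r) (h2 : r < n)
    (I : Ideal (MvPolynomial (Fin r) K)) (J : Ideal (MvPolynomial (Fin (n - r)) K))
    (hmI : IsMonomialIdeal I) (hmJ : IsMonomialIdeal J)
    (hI0 : I ≠ ⊥) (hI1 : I ≠ ⊤) (hJ0 : J ≠ ⊥) (hJ1 : J ≠ ⊤) :
    gradedDepth K n (MvPolynomial (Fin n) K ⧸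
        (extIdeal (Fin.castLE h2.le) I ⊓ extIdeal (sndEmbed h2.le) J)) =
      gradedDepth K n (MvPolynomial (Fin n) K ⧸
        (extIdeal (Fin.castLE h2.le) I ⊔ extIdeal (sndEmbed h2.le) J)) + 1 ∧
    gradedDepth K n (MvPolynomial (Fin n) K ⧸
        (extIdeal (Fin.castLE h2.le) I ⊔ extIdeal (sndEmbed h2.le) J)) =
      gradedDepth K r (MvPolynomial (Fin r) K ⧸ I) +
        gradedDepth K (n - r) (MvPolynomial (Fin (n - r)) K ⧸ J) := by
  have h := bijective_elim_castLE_sndEmbed h2.le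
  have hI := hmI.le_varIdeal hI1
  have hJ := hmJ.le_varIdeal hJ1
  refine ⟨gradedDepth_quotient_inf (extIdeal_le_varIdeal hI) (extIdeal_le_varIdeal hJ)
    (gradedDepth_add_lt_left h hI hJ hJ0) ?_, gradedDepth_quotient_extIdeal_sup h hI hJ⟩
  rw [sup_comm]
  exact gradedDepth_add_lt_left (bijective_elim_swap h) hJ hI hI0
end

section
/- Let I ⊂ S' = K[x_1,…,x_r] and J ⊂ S'' = K[x_{r+1},…,x_n] be monomial ideals, where 1 ≤ r < n, and let S = K[x_1,…,x_n]. Then depth_S(IS ∩ JS) = depth_S(IS + JS) + 1 = depth_{S'}(I) + depth_{S''}(J), and moreover depth_S((IS + JS)/IS) = depth_S(IS + JS). -/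
open MvPolynomial

universe u

section Depth

open CategoryTheory Abelian RingTheory.Sequence Pointwise

variable {R : Type u} [CommRing R]

/-- `HasDepth m d M`: there is an `M`-regular sequence of length `d` in `m` such that the quotient
of `M` by it contains a nonzero element killed by `m`. -/
def HasDepth (m : Ideal R) : ℕ → (M : Type u) → [AddCommGroup M] → [Module R M] → Prop
  | 0, M, _, _ => ∃ u : M, u ≠ 0 ∧ ∀ x ∈ m, x • u = 0
  | d + 1, M, _, _ => ∃ x ∈ m, IsSMulRegular M x ∧ HasDepth m d (QuotSMulTop x M)

variable {m : Ideal R} {M : Type u} [AddCommGroup M] [Module R M]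

theorem smul_top_quotSMulTop_eq_top (x : R) (h : m • (⊤ : Submodule R M) = ⊤) :
    m • (⊤ : Submodule R (QuotSMulTop x M)) = ⊤ := by
  have h' := congrArg (Submodule.map (x • (⊤ : Submodule R M)).mkQ) h
  rwa [Submodule.map_smul'', Submodule.map_top, Submodule.range_mkQ] at h'

theorem HasDepth.smul_top_ne_top {d : ℕ} [Module.Finite R M] (hd : HasDepth m d M) :
    m • (⊤ : Submodule R M) ≠ ⊤ := by
  induction d generalizing M with
  | zero =>
    obtain ⟨u, hu, hmu⟩ := hd
    intro h
    obtain ⟨r, hr, hr0⟩ := Submodule.exists_sub_one_mem_and_smul_eq_zero_of_fg_of_le_smul m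
      (⊤ : Submodule R M) Module.Finite.fg_top h.ge
    have h1 := hmu _ hr
    rw [sub_smul, hr0 u trivial, one_smul, zero_sub, neg_eq_zero] at h1
    exact hu h1
  | succ d ih =>
    obtain ⟨x, -, -, hd⟩ := hd
    exact fun h => ih hd (smul_top_quotSMulTop_eq_top x h)

theorem HasDepth.exists_isRegular {d : ℕ} (hd : HasDepth m d M) :
    ∃ rs : List R, rs.length = d ∧ (∀ x ∈ rs, x ∈ m) ∧ IsRegular M rs := by
  induction d generalizing M with
  | zero =>
    obtain ⟨u, hu, -⟩ := hd
    have : Nontrivial M := ⟨u, 0, hu⟩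
    exact ⟨[], rfl, by simp, IsRegular.nil R M⟩
  | succ d ih =>
    obtain ⟨x, hx, hreg, hd⟩ := hd
    obtain ⟨rs, hl, hmem, hrs⟩ := ih hd
    exact ⟨x :: rs, by simp [hl], by simpa [hx] using hmem, IsRegular.cons hreg hrs⟩

theorem subsingleton_ext_quotSMulTop (N : ModuleCat.{u} R) (M : ModuleCat.{u} R) {x : R}
    (hx : IsSMulRegular M x) {k : ℕ} (h : ∀ i < k + 1, Subsingleton (Ext N M i)) :
    ∀ i < k, Subsingleton (Ext N (ModuleCat.of R (QuotSMulTop x M)) i) := by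
  intro i hi
  have zero1 := AddCommGrpCat.isZero_of_iff_subsingleton.mpr (h i (by omega))
  have zero2 := AddCommGrpCat.isZero_of_iff_subsingleton.mpr (h (i + 1) (by omega))
  exact AddCommGrpCat.subsingleton_of_isZero <| ShortComplex.Exact.isZero_of_both_zeros
    ((Ext.covariant_sequence_exact₃' N hx.smulShortComplex_shortExact) i (i + 1) rfl)
    (zero1.eq_zero_of_src _) (zero2.eq_zero_of_tgt _)

theorem HasDepth.le_supportDim {d : ℕ} [Module.Finite R M] (hd : HasDepth m d M) :
    (d : WithBot ℕ∞) ≤ Module.supportDim R M := by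
  induction d generalizing M with
  | zero =>
    obtain ⟨u, hu, -⟩ := hd
    have : Nontrivial M := ⟨u, 0, hu⟩
    have := Order.krullDim_ne_bot_iff.mp (Module.supportDim_ne_bot_of_nontrivial R M)
    exact_mod_cast Order.krullDim_nonneg
  | succ d ih =>
    obtain ⟨x, hx, hreg, hd⟩ := hd
    have h1 := Module.supportDim_quotSMulTop_succ_le_of_notMem_minimalPrimes (M := M)
        fun _ => hreg.notMem_of_mem_minimalPrimes
    refine le_trans ?_ h1
    push_cast
    gcongr
    exact ih hd

variable [IsNoetherianRing R]

theorem exists_isRegular_iff_subsingleton_ext [Module.Finite R M]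
    (h : m • (⊤ : Submodule R M) ≠ ⊤) (k : ℕ) :
    (∃ rs : List R, rs.length = k ∧ (∀ x ∈ rs, x ∈ m) ∧ IsRegular M rs) ↔
      ∀ i < k, Subsingleton (Ext (ModuleCat.of R (Shrink.{u} (R ⧸ m))) (ModuleCat.of R M) i) :=
  ((ModuleCat.exists_isRegular_tfae m k (ModuleCat.of R M) h.lt_top).out 1 3).symm

theorem HasDepth.length_le {d : ℕ} [Module.Finite R M] (hd : HasDepth m d M) {ss : List R}
    (hmem : ∀ x ∈ ss, x ∈ m) (hss : IsRegular M ss) : ss.length ≤ d := by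
  induction d generalizing M ss with
  | zero =>
    obtain ⟨u, hu, hmu⟩ := hd
    match ss with
    | [] => simp
    | x :: ss =>
      have h1 := ((isRegular_cons_iff M x ss).mp hss).1
      exact absurd (h1 (a₁ := u) (a₂ := 0) (by simp [hmu x (hmem x (by simp))])) hu
  | succ d ih =>
    have hne := hd.smul_top_ne_top
    obtain ⟨x, hx, hreg, hd⟩ := hd
    match ss with
    | [] => simp
    | y :: ss =>
      have h1 := (exists_isRegular_iff_subsingleton_ext hne (ss.length + 1)).mp
        ⟨y :: ss, by simp, hmem, hss⟩
      have h2 := subsingleton_ext_quotSMulTop _ (ModuleCat.of R M) hreg h1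
      obtain ⟨ts, hl, hts, htr⟩ :=
        (exists_isRegular_iff_subsingleton_ext hd.smul_top_ne_top ss.length).mpr h2
      simpa [hl] using ih hd hts htr

theorem HasDepth.sSup_eq {d : ℕ} [Module.Finite R M] (hd : HasDepth m d M) :
    sSup {k : ℕ∞ | ∃ rs : List R, (rs.length : ℕ∞) = k ∧ (∀ x ∈ rs, x ∈ m) ∧
      IsRegular M rs} = d := by
  refine IsGreatest.csSup_eq ⟨?_, ?_⟩
  · obtain ⟨rs, rfl, h⟩ := hd.exists_isRegular
    exact ⟨rs, rfl, h⟩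
  · rintro _ ⟨rs, rfl, hmem, hrs⟩
    exact_mod_cast hd.length_le hmem hrs

theorem exists_ne_zero_smul_eq_zero [Module.Finite R M]
    (h : ∀ x ∈ m, ¬ IsSMulRegular M x) : ∃ u : M, u ≠ 0 ∧ ∀ x ∈ m, x • u = 0 := by
  by_contra! hu
  have : Subsingleton ((R ⧸ m) →ₗ[R] M) := by
    refine subsingleton_of_forall_eq 0 fun f => ?_
    ext
    by_contra hf
    obtain ⟨x, hx, hxf⟩ := hu (f 1) (by simpa using! hf)
    refine hxf ?_
    rw [← map_smul, ← f.map_zero]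
    congr 1
    exact Ideal.Quotient.eq_zero_iff_mem.mpr (by simpa using hx)
  obtain ⟨x, hx, hreg⟩ := IsSMulRegular.subsingleton_linearMap_iff.mp this
  rw [Ideal.annihilator_quotient] at hx
  exact h x hx hreg

theorem exists_hasDepth {n : ℕ} [Module.Finite R M] (hn : Module.supportDim R M < n)
    (h : m • (⊤ : Submodule R M) ≠ ⊤) : ∃ d, HasDepth m d M := by
  induction n generalizing M with
  | zero =>
    have hM : ¬ Nontrivial M := fun _ => by
      have := Module.supportDim_ne_bot_of_nontrivial R M
      have := Order.krullDim_ne_bot_iff.mp this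
      exact absurd hn (not_lt.mpr (by exact_mod_cast Order.krullDim_nonneg))
    rw [not_nontrivial_iff_subsingleton] at hM
    exact absurd (Subsingleton.elim _ _) h
  | succ n ih =>
    by_cases hx : ∃ x ∈ m, IsSMulRegular M x
    · obtain ⟨x, hx, hreg⟩ := hx
      have h1 := Module.supportDim_quotSMulTop_succ_le_of_notMem_minimalPrimes (M := M)
        fun _ => hreg.notMem_of_mem_minimalPrimes
      have h2 : m • (⊤ : Submodule R (QuotSMulTop x M)) ≠ ⊤ := by
        intro h'
        refine h (top_unique fun y _ => ?_)
        have h3 := congrArg (Submodule.comap (x • (⊤ : Submodule R M)).mkQ) h'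
        rw [Submodule.comap_smul_top_of_surjective m _ (Submodule.mkQ_surjective _)] at h3
        simp only [Submodule.ker_mkQ, Submodule.comap_top] at h3
        have h4 : x • (⊤ : Submodule R M) ≤ m • ⊤ := by
          rw [← Submodule.ideal_span_singleton_smul]
          exact Submodule.smul_mono_left ((Ideal.span_singleton_le_iff_mem m).mpr hx)
        rw [sup_eq_left.mpr h4] at h3
        rw [h3]; trivial
      obtain ⟨d, hd⟩ := ih (M := QuotSMulTop x M)
        (ENat.WithBot.add_one_le_natCast_iff.mp
        (h1.trans (ENat.WithBot.lt_add_one_iff.mp (by exact_mod_cast hn)))) h2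
      exact ⟨d + 1, x, hx, hreg, hd⟩
    · push Not at hx
      exact ⟨0, exists_ne_zero_smul_eq_zero hx⟩

theorem HasDepth.ideal {d : ℕ} {I : Ideal R} (hd : HasDepth m d (R ⧸ I))
    {e : ℕ} (he : HasDepth m e I)
    (hR : ∀ i < d + 1, Subsingleton
      (Ext (ModuleCat.of R (Shrink.{u} (R ⧸ m))) (ModuleCat.of R R) i)) :
    e = d + 1 := by
  let N := ModuleCat.of R (Shrink.{u} (R ⧸ m))
  let S : ShortComplex (ModuleCat.{u} R) := ShortComplex.mk
    (ModuleCat.ofHom I.subtype) (ModuleCat.ofHom I.mkQ) (by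
      ext x; exact (Submodule.Quotient.mk_eq_zero I).mpr x.2)
  have hS : S.ShortExact :=
    { exact := ModuleCat.shortComplex_exact _ (by
        simpa [S] using LinearMap.exact_subtype_mkQ I)
      mono_f := (ModuleCat.mono_iff_injective _).mpr I.injective_subtype
      epi_g := (ModuleCat.epi_iff_surjective _).mpr I.mkQ_surjective }
  refine le_antisymm ?_ ?_
  · by_contra! hlt
    have h1 := (exists_isRegular_iff_subsingleton_ext he.smul_top_ne_top e).mp he.exists_isRegular
    have h2 : ∀ i < d + 1, Subsingleton (Ext N (ModuleCat.of R (R ⧸ I)) i) := by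
      intro i hi
      have zero1 := AddCommGrpCat.isZero_of_iff_subsingleton.mpr (hR i hi)
      have zero2 := AddCommGrpCat.isZero_of_iff_subsingleton.mpr (h1 (i + 1) (by omega))
      exact AddCommGrpCat.subsingleton_of_isZero <| ShortComplex.Exact.isZero_of_both_zeros
        ((Ext.covariant_sequence_exact₃' N hS) i (i + 1) rfl)
        (zero1.eq_zero_of_src _) (zero2.eq_zero_of_tgt _)
    obtain ⟨rs, hl, hmem, hrs⟩ :=
      (exists_isRegular_iff_subsingleton_ext hd.smul_top_ne_top (d + 1)).mpr h2
    have := hd.length_le hmem hrs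
    omega
  · have h1 := (exists_isRegular_iff_subsingleton_ext hd.smul_top_ne_top d).mp hd.exists_isRegular
    have h2 : ∀ i < d + 1, Subsingleton (Ext N (ModuleCat.of R I) i) := by
      intro i hi
      match i with
      | 0 =>
        have := hR 0 (by omega)
        refine (Ext.addEquiv₀.trans ModuleCat.homAddEquiv).subsingleton_congr.mpr ?_
        have h3 := (Ext.addEquiv₀.trans ModuleCat.homAddEquiv).subsingleton_congr.mp this
        refine ⟨fun f g => ?_⟩
        have h4 := Subsingleton.elim (I.subtype ∘ₗ f) (I.subtype ∘ₗ g)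
        exact (LinearMap.cancel_left I.injective_subtype).mp h4
      | i + 1 =>
        have zero1 := AddCommGrpCat.isZero_of_iff_subsingleton.mpr (h1 i (by omega))
        have zero2 := AddCommGrpCat.isZero_of_iff_subsingleton.mpr (hR (i + 1) hi)
        exact AddCommGrpCat.subsingleton_of_isZero <| ShortComplex.Exact.isZero_of_both_zeros
          ((Ext.covariant_sequence_exact₁' N hS) i (i + 1) rfl)
          (zero1.eq_zero_of_src _) (zero2.eq_zero_of_tgt _)
    obtain ⟨rs, hl, hmem, hrs⟩ :=
      (exists_isRegular_iff_subsingleton_ext he.smul_top_ne_top (d + 1)).mpr h2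
    have := he.length_le hmem hrs
    omega

end Depth

section Vars
open RingTheory.Sequence
variable {K : Type u} [Field K] {n : ℕ}

local notation "𝔪" => Ideal.span (Set.range (X : Fin n → MvPolynomial (Fin n) K))

theorem mem_varIdeal_iff {p : MvPolynomial (Fin n) K} : p ∈ 𝔪 ↔ constantCoeff p = 0 := by
  rw [← Set.image_univ, mem_ideal_span_X_image, constantCoeff_eq]
  constructor
  · intro h
    by_contra h0
    obtain ⟨i, -, hi⟩ := h 0 (mem_support_iff.mpr h0)
    exact hi rfl
  · intro h a ha
    by_contra! hc
    have : a = 0 := Finsupp.ext fun i => by simpa using hc i (Set.mem_univ _)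
    exact mem_support_iff.mp ha (this ▸ h)

theorem varIdeal_ne_top_s4 : 𝔪 ≠ ⊤ := by
  rw [Ne, Ideal.eq_top_iff_one, mem_varIdeal_iff]
  simp

theorem mem_span_X_of_X_mul_mem {σ : Type*} {s : Set σ} {i : σ} (hi : i ∉ s)
    {p : MvPolynomial σ K} (h : X i * p ∈ Ideal.span (X '' s : Set (MvPolynomial σ K))) :
    p ∈ Ideal.span (X '' s : Set (MvPolynomial σ K)) := by
  classical
  rw [mem_ideal_span_X_image] at h ⊢
  intro a ha
  obtain ⟨j, hj, hne⟩ := h (Finsupp.single i 1 + a) (by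
    rw [mem_support_iff, coeff_X_mul]
    exact mem_support_iff.mp ha)
  refine ⟨j, hj, ?_⟩
  have : i ≠ j := fun h => hi (h ▸ hj)
  simpa [Finsupp.single_apply, this] using hne

theorem isRegular_X : IsRegular (MvPolynomial (Fin n) K)
    ((List.finRange n).map (X : Fin n → MvPolynomial (Fin n) K)) := by
  have hof (l : List (Fin n)) : Ideal.ofList (l.map (X : Fin n → MvPolynomial (Fin n) K)) •
      (⊤ : Ideal (MvPolynomial (Fin n) K)) = Ideal.span (X '' {i | i ∈ l}) := by
    rw [smul_eq_mul, Ideal.mul_top, Ideal.ofList]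
    congr 1
    ext; simp
  constructor
  · rw [isWeaklyRegular_iff]
    intro i hi
    rw [isSMulRegular_quotient_iff_mem_of_smul_mem]
    intro p hp
    rw [← List.map_take, hof] at hp ⊢
    have hi' : i < n := by simpa using hi
    refine mem_span_X_of_X_mul_mem (i := ⟨i, hi'⟩) ?_ (by simpa using hp)
    rw [Set.mem_ofPred_eq, List.mem_take_iff_getElem]
    rintro ⟨j, hj, h⟩
    simp only [List.getElem_finRange, Fin.ext_iff, Fin.val_cast] at h
    omega
  · rw [hof]
    simpa [Set.image_univ] using varIdeal_ne_top_s4.symm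

/-- A monomial ideal not containing `1` lies in the ideal generated by the variables. -/
theorem le_varIdeal_of_span_monomial {I : Ideal (MvPolynomial (Fin n) K)}
    (hI : ∃ G : Set (Fin n →₀ ℕ), I = Ideal.span ((fun a => monomial a (1 : K)) '' G))
    (h : I ≠ ⊤) : I ≤ 𝔪 := by
  obtain ⟨G, rfl⟩ := hI
  rw [Ideal.span_le]
  rintro _ ⟨a, ha, rfl⟩
  rw [SetLike.mem_coe, mem_varIdeal_iff]
  have ha0 : a ≠ 0 := by
    rintro rfl
    exact h (Ideal.eq_top_of_isUnit_mem _ (Ideal.subset_span ⟨0, ha, rfl⟩) (by simp))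
  simpa [constantCoeff_eq, coeff_monomial] using ha0

theorem varIdeal_smul_top_ne_top_of_ne_bot {I : Ideal (MvPolynomial (Fin n) K)} (hI : I ≠ ⊥) :
    𝔪 • (⊤ : Submodule (MvPolynomial (Fin n) K) I) ≠ ⊤ := by
  intro h
  obtain ⟨r, hr, hr0⟩ := Submodule.exists_sub_one_mem_and_smul_eq_zero_of_fg_of_le_smul 𝔪
      (⊤ : Submodule (MvPolynomial (Fin n) K) I) Module.Finite.fg_top h.ge
  obtain ⟨x, hx, hx0⟩ := Submodule.exists_mem_ne_zero_of_ne_bot hI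
  have h1 := congrArg Subtype.val (hr0 ⟨x, hx⟩ trivial)
  have h2 : r = 0 := by simpa [hx0] using h1
  rw [h2, mem_varIdeal_iff] at hr
  simp at hr

theorem varIdeal_smul_top_ne_top_of_le {I : Ideal (MvPolynomial (Fin n) K)} (hI : I ≤ 𝔪) :
    𝔪 • (⊤ : Submodule (MvPolynomial (Fin n) K) (MvPolynomial (Fin n) K ⧸ I)) ≠ ⊤ := by
  intro h
  have h3 := congrArg (Submodule.comap I.mkQ) h
  rw [Submodule.comap_smul_top_of_surjective _ _ (Submodule.mkQ_surjective _)] at h3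
  simp only [Submodule.ker_mkQ, Submodule.comap_top, smul_eq_mul, Ideal.mul_top] at h3
  rw [sup_eq_left.mpr hI] at h3
  exact varIdeal_ne_top_s4 h3

theorem supportDim_lt (M : Type u) [AddCommGroup M] [Module (MvPolynomial (Fin n) K) M] :
    Module.supportDim (MvPolynomial (Fin n) K) M < (n + 1 : ℕ) := by
  refine lt_of_le_of_lt (Module.supportDim_le_ringKrullDim _ M) ?_
  rw [MvPolynomial.ringKrullDim_of_isNoetherianRing, ringKrullDim_eq_zero_of_field]
  simp only [Nat.card_eq_fintype_card, Fintype.card_fin, zero_add]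
  exact_mod_cast Nat.lt_succ_self n

theorem HasDepth.of_quotient {I : Ideal (MvPolynomial (Fin n) K)} (hI : I ≠ ⊥)
    {d : ℕ} (hd : HasDepth 𝔪 d (MvPolynomial (Fin n) K ⧸ I)) : HasDepth 𝔪 (d + 1) I := by
  obtain ⟨e, he⟩ := exists_hasDepth (supportDim_lt I) (varIdeal_smul_top_ne_top_of_ne_bot hI)
  have hdn : d < n := by
    have h1 := hd.le_supportDim
    rw [Module.supportDim_quotient_eq_ringKrullDim] at h1
    obtain ⟨x, hx, hx0⟩ := Submodule.exists_mem_ne_zero_of_ne_bot hI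
    have h2 := ringKrullDim_quotient_succ_le_of_nonZeroDivisor (mem_nonZeroDivisors_of_ne_zero hx0)
    have h3 := ringKrullDim_le_of_surjective _ (Ideal.Quotient.factor_surjective
      ((Ideal.span_singleton_le_iff_mem I).mpr hx))
    rw [MvPolynomial.ringKrullDim_of_isNoetherianRing, ringKrullDim_eq_zero_of_field] at h2
    simp only [Nat.card_eq_fintype_card, Fintype.card_fin, zero_add] at h2
    have h4 := (ENat.WithBot.add_one_le_natCast_iff.mp h2)
    exact_mod_cast (h1.trans h3).trans_lt h4
  have hX := (exists_isRegular_iff_subsingleton_ext (M := MvPolynomial (Fin n) K) (m := 𝔪)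
    (by simpa using varIdeal_ne_top_s4) n).mp ⟨_, by simp, by
      simpa using fun i => Ideal.subset_span (Set.mem_range_self i), isRegular_X⟩
  exact hd.ideal he (fun i hi => hX i (by omega)) ▸ he

theorem HasDepth.gradedDepth_eq {M : Type u} [AddCommGroup M] [Module (MvPolynomial (Fin n) K) M]
    [Module.Finite (MvPolynomial (Fin n) K) M] {d : ℕ} (hd : HasDepth 𝔪 d M) :
    gradedDepth K n M = d :=
  hd.sSup_eq

end Vars

section Tensor

open TensorProduct Pointwise

variable {K : Type u} [Field K] {R₁ R₂ S : Type u} [CommRing R₁] [CommRing R₂] [CommRing S]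

/-- An additive isomorphism from `M ⊗[K] N` to an `S`-module `T` which identifies the actions of
`R₁` on `M` and of `R₂` on `N` with the actions on `T` through `f₁ : R₁ → S` and `f₂ : R₂ → S`. -/
structure ExternalTensor (f₁ : R₁ → S) (f₂ : R₂ → S) (M N T : Type u)
    [AddCommGroup M] [AddCommGroup N] [AddCommGroup T]
    [Module R₁ M] [Module R₂ N] [Module S T] [Module K M] [Module K N] where
  /-- The underlying isomorphism. -/
  equiv : M ⊗[K] N ≃+ T
  smul_left : ∀ a m n, equiv ((a • m) ⊗ₜ n) = f₁ a • equiv (m ⊗ₜ n)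
  smul_right : ∀ b m n, equiv (m ⊗ₜ (b • n)) = f₂ b • equiv (m ⊗ₜ n)

theorem tmul_ne_zero {M N : Type*} [AddCommGroup M] [AddCommGroup N] [Module K M] [Module K N]
    {u : M} {v : N} (hu : u ≠ 0) (hv : v ≠ 0) : u ⊗ₜ[K] v ≠ 0 := by
  have h := Module.Flat.lTensor_preserves_injective_linearMap (M := M)
    (LinearMap.toSpanSingleton K N v)
    (LinearMap.ker_eq_bot.mp (LinearMap.ker_toSpanSingleton K hv))
  rw [← one_smul K v]
  intro h0
  have h1 : u ⊗ₜ[K] (1 : K) = 0 := h (by simpa using h0)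
  exact hu (by simpa using congrArg (TensorProduct.rid K M) h1)

variable {f₁ : R₁ → S} {f₂ : R₂ → S} {M N T : Type u}
    [AddCommGroup M] [AddCommGroup N] [AddCommGroup T]
    [Module R₁ M] [Module R₂ N] [Module S T] [Module K M] [Module K N]

/-- Exchanging the two factors. -/
noncomputable def ExternalTensor.swap (e : ExternalTensor (K := K) f₁ f₂ M N T) :
    ExternalTensor (K := K) f₂ f₁ N M T where
  equiv := (TensorProduct.comm K N M).toAddEquiv.trans e.equiv
  smul_left b n m := e.smul_right b m n
  smul_right a n m := e.smul_left a m n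

theorem exists_addEquiv_of_surjective {A B C D : Type*} [AddCommGroup A] [AddCommGroup B]
    [AddCommGroup C] [AddCommGroup D] (e : A ≃+ C) {φ : A →+ B} {ψ : C →+ D}
    (hφ : Function.Surjective φ) (hψ : Function.Surjective ψ) (h : ∀ a, φ a = 0 ↔ ψ (e a) = 0) :
    ∃ e' : B ≃+ D, ∀ a, e' (φ a) = ψ (e a) := by
  let χ : A →+ D := ψ.comp e.toAddMonoidHom
  have hχ : Function.Surjective χ := hψ.comp e.surjective
  have hker : φ.ker = χ.ker := by
    ext a
    exact h a
  refine ⟨(QuotientAddGroup.quotientKerEquivOfSurjective φ hφ).symm.trans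
    ((QuotientAddGroup.quotientAddEquivOfEq hker).trans
      (QuotientAddGroup.quotientKerEquivOfSurjective χ hχ)), fun a => ?_⟩
  have : (QuotientAddGroup.quotientKerEquivOfSurjective φ hφ).symm (φ a) = (a : A ⧸ φ.ker) := by
    rw [AddEquiv.symm_apply_eq]
    rfl
  rw [AddEquiv.trans_apply, this]
  rfl

variable {M' N' T' : Type u} [AddCommGroup M'] [AddCommGroup N'] [AddCommGroup T']
    [Module R₁ M'] [Module R₂ N'] [Module S T'] [Module K M'] [Module K N']

/-- Passing to quotients of the two factors. -/
theorem ExternalTensor.exists_of_surjective (e : ExternalTensor (K := K) f₁ f₂ M N T)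
    {g : M →ₗ[K] M'} {h : N →ₗ[K] N'} {p : T →ₗ[S] T'} (hg : Function.Surjective g)
    (hh : Function.Surjective h) (hp : Function.Surjective p)
    (hga : ∀ (a : R₁) m, g (a • m) = a • g m) (hhb : ∀ (b : R₂) n, h (b • n) = b • h n)
    (hker : ∀ t, TensorProduct.map g h t = 0 ↔ p (e.equiv t) = 0) :
    ∃ e' : ExternalTensor (K := K) f₁ f₂ M' N' T',
      ∀ t, e'.equiv (TensorProduct.map g h t) = p (e.equiv t) := by
  obtain ⟨e', he'⟩ := exists_addEquiv_of_surjective e.equiv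
    (φ := (TensorProduct.map g h).toAddMonoidHom)
    (ψ := p.toAddMonoidHom) (TensorProduct.map_surjective hg hh) hp hker
  have he'' := he'
  replace he' (m : M) (n : N) : e' (g m ⊗ₜ h n) = p (e.equiv (m ⊗ₜ n)) := he' (m ⊗ₜ n)
  refine ⟨⟨e', fun a m n => ?_, fun b m n => ?_⟩, he''⟩ <;>
  obtain ⟨m, rfl⟩ := hg m <;> obtain ⟨n, rfl⟩ := hh n
  · rw [← hga, he', he', e.smul_left, map_smul]
  · rw [← hhb, he', he', e.smul_right, map_smul]

/-- Passing to submodules of the two factors. -/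
theorem ExternalTensor.nonempty_of_injective (e : ExternalTensor (K := K) f₁ f₂ M' N' T')
    {g : M →ₗ[K] M'} {h : N →ₗ[K] N'} {i : T →ₗ[S] T'} (hg : Function.Injective g)
    (hh : Function.Injective h) (hi : Function.Injective i)
    (hga : ∀ (a : R₁) m, g (a • m) = a • g m) (hhb : ∀ (b : R₂) n, h (b • n) = b • h n)
    (hrange : ∀ t, (∃ s, TensorProduct.map g h s = t) ↔ ∃ s, i s = e.equiv t) :
    Nonempty (ExternalTensor (K := K) f₁ f₂ M N T) := by
  have hgh : Function.Injective (TensorProduct.map g h) := by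
    rw [← LinearMap.lTensor_comp_rTensor]
    exact (Module.Flat.lTensor_preserves_injective_linearMap _ hh).comp
      (Module.Flat.rTensor_preserves_injective_linearMap _ hg)
  have h1 (s : M ⊗[K] N) := (hrange _).mp ⟨s, rfl⟩
  choose f hf using h1
  have hadd (s t : M ⊗[K] N) : f (s + t) = f s + f t := hi (by simp [hf])
  have hbij : Function.Bijective f := by
    refine ⟨fun s t hst => hgh (e.equiv.injective ?_), fun t => ?_⟩
    · rw [← hf, ← hf, hst]
    · obtain ⟨s, hs⟩ := (hrange (e.equiv.symm (i t))).mpr ⟨t, by simp⟩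
      exact ⟨s, hi (by simp [hf, hs])⟩
  refine ⟨AddEquiv.ofBijective (AddMonoidHom.mk' f hadd) hbij, fun a m n => hi ?_,
    fun b m n => hi ?_⟩
  · rw [map_smul]
    change i (f _) = f₁ a • i (f _)
    rw [hf, hf, TensorProduct.map_tmul, TensorProduct.map_tmul, hga, e.smul_left]
  · rw [map_smul]
    change i (f _) = f₂ b • i (f _)
    rw [hf, hf, TensorProduct.map_tmul, TensorProduct.map_tmul, hhb, e.smul_right]

variable [Algebra K R₁] [IsScalarTower K R₁ M]

theorem ExternalTensor.equiv_rTensor_lsmul (e : ExternalTensor (K := K) f₁ f₂ M N T) (x : R₁)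
    (t : M ⊗[K] N) : e.equiv (((Module.toModuleEnd K M x).rTensor N) t) = f₁ x • e.equiv t := by
  induction t with
  | zero => simp
  | tmul m n => exact e.smul_left x m n
  | add s t hs ht => rw [map_add, map_add, hs, ht, map_add, smul_add]

theorem ExternalTensor.isSMulRegular (e : ExternalTensor (K := K) f₁ f₂ M N T) {x : R₁}
    (hx : IsSMulRegular M x) : IsSMulRegular T (f₁ x) := by
  have h := Module.Flat.rTensor_preserves_injective_linearMap (M := N)
    (Module.toModuleEnd K M x) hx
  intro s t hst
  obtain ⟨s, rfl⟩ := e.equiv.surjective s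
  obtain ⟨t, rfl⟩ := e.equiv.surjective t
  simp only [← e.equiv_rTensor_lsmul] at hst
  rw [h (e.equiv.injective hst)]

theorem ExternalTensor.nonempty_of_exact (e : ExternalTensor (K := K) f₁ f₂ M N T) (x : R₁)
    {g : M →ₗ[K] M'} {p : T →ₗ[S] T'} (hg : Function.Surjective g) (hp : Function.Surjective p)
    (hga : ∀ (a : R₁) m, g (a • m) = a • g m) (hgx : ∀ y, g y = 0 ↔ ∃ z, x • z = y)
    (hpx : ∀ t, p t = 0 ↔ ∃ s, f₁ x • s = t) :
    Nonempty (ExternalTensor (K := K) f₁ f₂ M' N T') := by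
  have hex : Function.Exact (Module.toModuleEnd K M x) g := hgx
  refine (e.exists_of_surjective (h := LinearMap.id) hg Function.surjective_id hp hga
    (fun _ _ => rfl) fun t => (rTensor_exact N hex hg t).trans ?_).nonempty
  rw [hpx]
  constructor
  · rintro ⟨s, rfl⟩
    exact ⟨e.equiv s, (e.equiv_rTensor_lsmul x s).symm⟩
  · rintro ⟨s, hs⟩
    refine ⟨e.equiv.symm s, e.equiv.injective ?_⟩
    rw [e.equiv_rTensor_lsmul, AddEquiv.apply_symm_apply, hs]

theorem exists_linearMap_quotSMulTop {R M : Type*} [CommRing R] [AddCommGroup M] [Module R M]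
    (x : R) : ∃ g : M →ₗ[R] QuotSMulTop x M, Function.Surjective g ∧
      ∀ y, g y = 0 ↔ ∃ z, x • z = y :=
  ⟨Submodule.mkQ _, Submodule.mkQ_surjective _, fun _ =>
    (Submodule.Quotient.mk_eq_zero _).trans (by simp [Submodule.mem_smul_pointwise_iff_exists])⟩

/-- Passing to the quotient by an element acting on the left factor. -/
theorem ExternalTensor.nonempty_quotSMulTop
    (e : ExternalTensor (K := K) f₁ f₂ M N T) (x : R₁) :
    Nonempty (ExternalTensor (K := K) f₁ f₂ (QuotSMulTop x M) N (QuotSMulTop (f₁ x) T)) := by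
  obtain ⟨g, hg, hgx⟩ := exists_linearMap_quotSMulTop (M := M) x
  obtain ⟨p, hp, hpx⟩ := exists_linearMap_quotSMulTop (M := T) (f₁ x)
  exact e.nonempty_of_exact x (g := g.restrictScalars K) hg hp g.map_smul hgx hpx

/-- The depth of an external tensor product over a field is the sum of the depths. -/
theorem ExternalTensor.hasDepth [Algebra K R₂] [IsScalarTower K R₂ N]
    (e : ExternalTensor (K := K) f₁ f₂ M N T)
    {m₁ : Ideal R₁} {m₂ : Ideal R₂} {m : Ideal S} (hm : m = Ideal.span (f₁ '' m₁ ∪ f₂ '' m₂))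
    {c d : ℕ} (hM : HasDepth m₁ c M) (hN : HasDepth m₂ d N) : HasDepth m (c + d) T := by
  induction c generalizing M T with
  | zero =>
    induction d generalizing N T with
    | zero =>
      obtain ⟨u, hu, hmu⟩ := hM
      obtain ⟨v, hv, hmv⟩ := hN
      refine ⟨e.equiv (u ⊗ₜ v), ?_, fun x hx => ?_⟩
      · rw [Ne, EmbeddingLike.map_eq_zero_iff]
        exact tmul_ne_zero hu hv
      · rw [hm] at hx
        rw [← Submodule.mem_annihilator_span_singleton]
        revert x
        change Ideal.span _ ≤ _
        rw [Ideal.span_le]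
        rintro _ (⟨a, ha, rfl⟩ | ⟨b, hb, rfl⟩)
        · rw [SetLike.mem_coe, Submodule.mem_annihilator_span_singleton, ← e.smul_left, hmu a ha]
          simp
        · rw [SetLike.mem_coe, Submodule.mem_annihilator_span_singleton, ← e.smul_right, hmv b hb]
          simp
    | succ d ih =>
      obtain ⟨x, hx, hreg, hN⟩ := hN
      obtain ⟨e'⟩ := e.swap.nonempty_quotSMulTop x
      exact ⟨f₂ x, hm ▸ Ideal.subset_span (Or.inr ⟨x, hx, rfl⟩), e.swap.isSMulRegular hreg,
        ih hN e'.swap⟩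
  | succ c ih =>
    obtain ⟨x, hx, hreg, hM⟩ := hM
    obtain ⟨e'⟩ := e.nonempty_quotSMulTop x
    rw [Nat.add_right_comm]
    exact ⟨f₁ x, hm ▸ Ideal.subset_span (Or.inl ⟨x, hx, rfl⟩), e.isSMulRegular hreg,
      ih e' hM⟩

end Tensor

section TensorAlgebra

open TensorProduct

variable {K : Type u} [Field K]

theorem range_map_eq_inf {V W M N : Type*} [AddCommGroup V] [AddCommGroup W] [AddCommGroup M]
    [AddCommGroup N] [Module K V] [Module K W] [Module K M] [Module K N] {i : V →ₗ[K] M}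
    (hi : Function.Injective i) (j : W →ₗ[K] N) :
    LinearMap.range (TensorProduct.map i j) =
      LinearMap.range (i.rTensor N) ⊓ LinearMap.range (j.lTensor M) := by
  refine le_antisymm (le_inf ?_ ?_) ?_
  · rw [← LinearMap.rTensor_comp_lTensor]
    exact LinearMap.range_comp_le_range _ _
  · rw [← LinearMap.lTensor_comp_rTensor]
    exact LinearMap.range_comp_le_range _ _
  · rintro _ ⟨⟨s, rfl⟩, hs⟩
    have hj := LinearMap.exact_map_mkQ_range j
    have hsurj := Submodule.mkQ_surjective (LinearMap.range j)
    have h1 := (lTensor_exact M hj hsurj _).mpr hs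
    rw [← LinearMap.comp_apply, LinearMap.lTensor_comp_rTensor, ← LinearMap.rTensor_comp_lTensor,
      LinearMap.comp_apply] at h1
    have h2 := Module.Flat.rTensor_preserves_injective_linearMap _ hi (h1.trans (map_zero _).symm)
    obtain ⟨t, rfl⟩ := (lTensor_exact V hj hsurj _).mp h2
    exact ⟨t, by rw [← LinearMap.rTensor_comp_lTensor]; rfl⟩

theorem ker_mkₐ {A : Type*} [CommRing A] [Algebra K A] (I : Ideal A) :
    RingHom.ker (Ideal.Quotient.mkₐ K I) = I :=
  Ideal.Quotient.mkₐ_ker K I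

variable {R₁ R₂ S : Type u} [CommRing R₁] [CommRing R₂] [CommRing S]
  [Algebra K R₁] [Algebra K R₂] [Algebra K S] {f₁ : R₁ →ₐ[K] S} {f₂ : R₂ →ₐ[K] S}
  {E : R₁ ⊗[K] R₂ ≃ₐ[K] S}

/-- A tensor product of algebras as an external tensor product. -/
noncomputable def ExternalTensor.ofAlgEquiv (hE : ∀ a b, E (a ⊗ₜ b) = f₁ a * f₂ b) :
    ExternalTensor (K := K) f₁ f₂ R₁ R₂ S where
  equiv := E.toAddEquiv
  smul_left a m n := by
    change E _ = f₁ a * E _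
    rw [hE, hE, smul_eq_mul, map_mul, mul_assoc]
  smul_right b m n := by
    change E _ = f₂ b * E _
    rw [hE, hE, smul_eq_mul, map_mul, mul_left_comm]

theorem ExternalTensor.ofAlgEquiv_equiv (hE : ∀ a b, E (a ⊗ₜ b) = f₁ a * f₂ b)
    (t : R₁ ⊗[K] R₂) :
    (ExternalTensor.ofAlgEquiv hE).equiv t = E t := rfl

theorem AlgEquiv.apply_mem_ideal_map {A B : Type*} [CommRing A] [CommRing B] [Algebra K A]
    [Algebra K B] (E : A ≃ₐ[K] B) {I : Ideal A} {t : A} : E t ∈ I.map E ↔ t ∈ I := by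
  rw [Ideal.mem_map_of_equiv]
  simp

theorem map_eq_map_includeLeft (hE : ∀ a b, E (a ⊗ₜ b) = f₁ a * f₂ b)
    (I : Ideal R₁) : I.map f₁ =
    (I.map (Algebra.TensorProduct.includeLeft : R₁ →ₐ[K] R₁ ⊗[K] R₂)).map E := by
  have h (x : R₁) : f₁ x = E (x ⊗ₜ 1) := by simp [hE]
  refine le_antisymm (Ideal.map_le_iff_le_comap.mpr fun x hx => ?_)
    (Ideal.map_le_iff_le_comap.mpr (Ideal.map_le_iff_le_comap.mpr fun x hx => ?_))
  · rw [Ideal.mem_comap, h]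
    exact Ideal.mem_map_of_mem _ (Ideal.mem_map_of_mem _ hx)
  · rw [Ideal.mem_comap, Ideal.mem_comap, Algebra.TensorProduct.includeLeft_apply, ← h]
    exact Ideal.mem_map_of_mem _ hx

theorem map_eq_map_includeRight (hE : ∀ a b, E (a ⊗ₜ b) = f₁ a * f₂ b)
    (J : Ideal R₂) : J.map f₂ =
    (J.map (Algebra.TensorProduct.includeRight : R₂ →ₐ[K] R₁ ⊗[K] R₂)).map E := by
  have h (x : R₂) : f₂ x = E (1 ⊗ₜ x) := by simp [hE]
  refine le_antisymm (Ideal.map_le_iff_le_comap.mpr fun x hx => ?_)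
    (Ideal.map_le_iff_le_comap.mpr (Ideal.map_le_iff_le_comap.mpr fun x hx => ?_))
  · rw [Ideal.mem_comap, h]
    exact Ideal.mem_map_of_mem _ (Ideal.mem_map_of_mem _ hx)
  · rw [Ideal.mem_comap, Ideal.mem_comap, Algebra.TensorProduct.includeRight_apply, ← h]
    exact Ideal.mem_map_of_mem _ hx

theorem apply_mem_map_left (hE : ∀ a b, E (a ⊗ₜ b) = f₁ a * f₂ b)
    (I : Ideal R₁) (t : R₁ ⊗[K] R₂) : E t ∈ I.map f₁ ↔
    t ∈ LinearMap.range ((Submodule.subtype (I.restrictScalars K)).rTensor R₂) := by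
  rw [map_eq_map_includeLeft hE, AlgEquiv.apply_mem_ideal_map, ← Ideal.map_includeLeft_eq]
  rfl

theorem apply_mem_map_right (hE : ∀ a b, E (a ⊗ₜ b) = f₁ a * f₂ b)
    (J : Ideal R₂) (t : R₁ ⊗[K] R₂) : E t ∈ J.map f₂ ↔
    t ∈ LinearMap.range ((Submodule.subtype (J.restrictScalars K)).lTensor R₁) := by
  rw [map_eq_map_includeRight hE, AlgEquiv.apply_mem_ideal_map, ← Ideal.map_includeRight_eq]
  rfl

/-- The intersection of two extended ideals is the tensor product of the ideals. -/
theorem nonempty_externalTensor_inf (hE : ∀ a b, E (a ⊗ₜ b) = f₁ a * f₂ b)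
    (I : Ideal R₁) (J : Ideal R₂) :
    Nonempty (ExternalTensor (K := K) f₁ f₂ I J ↥(I.map f₁ ⊓ J.map f₂)) := by
  refine (ExternalTensor.ofAlgEquiv hE).nonempty_of_injective
    (g := Submodule.subtype (I.restrictScalars K)) (h := Submodule.subtype (J.restrictScalars K))
    (i := Submodule.subtype _) Subtype.val_injective Subtype.val_injective Subtype.val_injective
    (fun _ _ => rfl) (fun _ _ => rfl) fun t => ?_
  rw [ExternalTensor.ofAlgEquiv_equiv]
  refine Iff.trans (b := E t ∈ I.map f₁ ⊓ J.map f₂) ?_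
    ⟨fun h => ⟨⟨_, h⟩, rfl⟩, fun ⟨s, hs⟩ => hs ▸ s.2⟩
  rw [Submodule.mem_inf, apply_mem_map_left hE, apply_mem_map_right hE, ← Submodule.mem_inf,
    ← range_map_eq_inf Subtype.val_injective]
  rfl

/-- The quotient by the sum of two extended ideals is the tensor product of the quotients. -/
theorem nonempty_externalTensor_quotient_sup (hE : ∀ a b, E (a ⊗ₜ b) = f₁ a * f₂ b)
    (I : Ideal R₁) (J : Ideal R₂) :
    Nonempty (ExternalTensor (K := K) f₁ f₂ (R₁ ⧸ I) (R₂ ⧸ J) (S ⧸ (I.map f₁ ⊔ J.map f₂))) := by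
  refine ((ExternalTensor.ofAlgEquiv hE).exists_of_surjective
    (g := (Ideal.Quotient.mkₐ K I).toLinearMap) (h := (Ideal.Quotient.mkₐ K J).toLinearMap)
    (p := (I.map f₁ ⊔ J.map f₂).mkQ) Ideal.Quotient.mk_surjective Ideal.Quotient.mk_surjective
    Ideal.Quotient.mk_surjective (fun _ _ => rfl) (fun _ _ => rfl) fun t => ?_).nonempty
  rw [ExternalTensor.ofAlgEquiv_equiv, map_eq_map_includeLeft hE, map_eq_map_includeRight hE,
    ← Ideal.map_sup, Submodule.mkQ_apply, Submodule.Quotient.mk_eq_zero,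
    AlgEquiv.apply_mem_ideal_map]
  have h := Algebra.TensorProduct.map_ker (Ideal.Quotient.mkₐ K I) (Ideal.Quotient.mkₐ K J)
    Ideal.Quotient.mk_surjective Ideal.Quotient.mk_surjective
  rw [ker_mkₐ, ker_mkₐ] at h
  rw [← h]
  rfl

/-- The quotient by an extended ideal, as an external tensor product. -/
theorem exists_externalTensor_quotient (hE : ∀ a b, E (a ⊗ₜ b) = f₁ a * f₂ b)
    (I : Ideal R₁) :
    ∃ e : ExternalTensor (K := K) f₁ f₂ (R₁ ⧸ I) R₂ (S ⧸ I.map f₁),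
      ∀ t, e.equiv ((Ideal.Quotient.mkₐ K I).toLinearMap.rTensor R₂ t) =
        (I.map f₁).mkQ (E t) := by
  refine (ExternalTensor.ofAlgEquiv hE).exists_of_surjective
    (g := (Ideal.Quotient.mkₐ K I).toLinearMap) (h := LinearMap.id)
    (p := (I.map f₁).mkQ) Ideal.Quotient.mk_surjective Function.surjective_id
    Ideal.Quotient.mk_surjective (fun _ _ => rfl) (fun _ _ => rfl) fun t => ?_
  rw [ExternalTensor.ofAlgEquiv_equiv, map_eq_map_includeLeft hE, Submodule.mkQ_apply,
    Submodule.Quotient.mk_eq_zero, AlgEquiv.apply_mem_ideal_map]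
  have h := Algebra.TensorProduct.rTensor_ker (R := K) (C := R₂) (Ideal.Quotient.mkₐ K I)
    Ideal.Quotient.mk_surjective
  rw [ker_mkₐ] at h
  rw [← h]
  rfl

/-- The image of an extended ideal in the quotient by the other one, as an external tensor
product. -/
theorem nonempty_externalTensor_map_mkQ (hE : ∀ a b, E (a ⊗ₜ b) = f₁ a * f₂ b)
    (I : Ideal R₁) (J : Ideal R₂) :
    Nonempty (ExternalTensor (K := K) f₁ f₂ (R₁ ⧸ I) J
      ↥(Submodule.map (I.map f₁).mkQ (I.map f₁ ⊔ J.map f₂))) := by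
  obtain ⟨e, he⟩ := exists_externalTensor_quotient hE I
  let j : J →ₗ[K] R₂ := Submodule.subtype (J.restrictScalars K)
  refine e.nonempty_of_injective (g := LinearMap.id) (h := j) (i := Submodule.subtype _)
    Function.injective_id Subtype.val_injective Subtype.val_injective
    (fun _ _ => rfl) (fun _ _ => rfl) fun t => ?_
  refine Iff.trans (b := e.equiv t ∈ Submodule.map (I.map f₁).mkQ (I.map f₁ ⊔ J.map f₂)) ?_
    ⟨fun h => ⟨⟨_, h⟩, rfl⟩, fun ⟨s, hs⟩ => hs ▸ s.2⟩
  let q : R₁ →ₗ[K] R₁ ⧸ I := (Ideal.Quotient.mkₐ K I).toLinearMap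
  have hcomm (s : R₁ ⊗[K] J) :
      e.equiv (j.lTensor (R₁ ⧸ I) (q.rTensor J s)) = (I.map f₁).mkQ (E (j.lTensor R₁ s)) := by
    rw [← he, ← LinearMap.comp_apply, LinearMap.lTensor_comp_rTensor,
      ← LinearMap.rTensor_comp_lTensor, LinearMap.comp_apply]
  constructor
  · rintro ⟨s, rfl⟩
    obtain ⟨s, rfl⟩ := LinearMap.rTensor_surjective J (g := q) Ideal.Quotient.mk_surjective s
    exact ⟨E (j.lTensor R₁ s), Ideal.mem_sup_right ((apply_mem_map_right hE J _).mpr ⟨s, rfl⟩),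
      (hcomm s).symm⟩
  · rintro ⟨y, hy, hyt⟩
    obtain ⟨a, ha, b, hb, rfl⟩ := Submodule.mem_sup.mp hy
    obtain ⟨b, rfl⟩ := E.surjective b
    obtain ⟨s, hs⟩ : ∃ s : R₁ ⊗[K] J, j.lTensor R₁ s = b := (apply_mem_map_right hE J b).mp hb
    have ha0 : (I.map f₁).mkQ a = 0 := (Submodule.Quotient.mk_eq_zero _).mpr ha
    refine ⟨q.rTensor J s, e.equiv.injective ((hcomm s).trans ?_)⟩
    rw [hs, ← hyt, map_add, ha0, zero_add]

end TensorAlgebra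

section Embed

open TensorProduct

variable (K : Type u) [Field K] {n r : ℕ}

/-- The variables of `K[x_1,…,x_n]` split into the first `r` and the last `n - r`. -/
def sumEquivFin (h : r ≤ n) : Fin r ⊕ Fin (n - r) ≃ Fin n :=
  finSumFinEquiv.trans (finCongr (Nat.add_sub_cancel' h))

theorem sumEquivFin_inl (h : r ≤ n) (i : Fin r) : sumEquivFin h (Sum.inl i) = Fin.castLE h i :=
  rfl

theorem sumEquivFin_inr (h : r ≤ n) (i : Fin (n - r)) :
    sumEquivFin h (Sum.inr i) = sndEmbed h i :=
  rfl

/-- A polynomial ring in `n` variables as a tensor product of polynomial rings in the first `r` and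
the last `n - r` variables. -/
noncomputable def tensorEquivFin (h : r ≤ n) :
    MvPolynomial (Fin r) K ⊗[K] MvPolynomial (Fin (n - r)) K ≃ₐ[K] MvPolynomial (Fin n) K :=
  (tensorEquivSum K (Fin r) (Fin (n - r)) K).trans (renameEquiv K (sumEquivFin h))

theorem tensorEquivFin_tmul (h : r ≤ n) (a : MvPolynomial (Fin r) K)
    (b : MvPolynomial (Fin (n - r)) K) :
    tensorEquivFin K h (a ⊗ₜ b) = rename (Fin.castLE h) a * rename (sndEmbed h) b := by
  have key : (tensorEquivFin K h).toAlgHom = Algebra.TensorProduct.productMap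
      (rename (Fin.castLE h)) (rename (sndEmbed h)) := by
    ext i
    · simp [tensorEquivFin, sumEquivFin_inl]
    · simp [tensorEquivFin, sumEquivFin_inr]
  exact DFunLike.congr_fun key (a ⊗ₜ b)

theorem span_range_X_eq (h : r ≤ n) :
    Ideal.span (Set.range (X : Fin n → MvPolynomial (Fin n) K)) =
      Ideal.span ((rename (Fin.castLE h) : MvPolynomial (Fin r) K →ₐ[K] _) ''
          (Ideal.span (Set.range (X : Fin r → MvPolynomial (Fin r) K))) ∪
        (rename (sndEmbed h) : MvPolynomial (Fin (n - r)) K →ₐ[K] _) ''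
          (Ideal.span (Set.range (X : Fin (n - r) → MvPolynomial (Fin (n - r)) K)))) := by
  have hspan {k : ℕ} (f : Fin k → Fin n) :
      Ideal.span ((rename f : MvPolynomial (Fin k) K →ₐ[K] MvPolynomial (Fin n) K) ''
        (Ideal.span (Set.range (X : Fin k → MvPolynomial (Fin k) K)))) =
      Ideal.span (X '' Set.range f) := by
    refine (Ideal.map_span (rename f : MvPolynomial (Fin k) K →ₐ[K] _) _).trans ?_
    rw [← Set.range_comp, ← Set.range_comp]
    congr 2
    ext1 i
    exact rename_X f i
  rw [Ideal.span_union, hspan, hspan, ← Ideal.span_union, ← Set.image_union, ← Set.image_univ,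
    ← (sumEquivFin h).surjective.range_eq, Sum.range_eq]
  rfl

end Embed

/-- For monomial ideals `I ⊂ S' = K[x_1,…,x_r]` and
`J ⊂ S'' = K[x_{r+1},…,x_n]` with `1 ≤ r < n`, one has
`depth_S(IS ∩ JS) = depth_S(IS + JS) + 1 = depth_{S'}(I) + depth_{S''}(J)` and
`depth_S((IS + JS)/IS) = depth_S(IS + JS)`. -/
theorem depth_ideal_disjoint_vars {K : Type*} [Field K] {n r : ℕ}
    (h1 : 1 ≤ r) (h2 : r < n)
    (I : Ideal (MvPolynomial (Fin r) K)) (J : Ideal (MvPolynomial (Fin (n - r)) K))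
    (hmI : IsMonomialIdeal I) (hmJ : IsMonomialIdeal J)
    (hI0 : I ≠ ⊥) (hI1 : I ≠ ⊤) (hJ0 : J ≠ ⊥) (hJ1 : J ≠ ⊤) :
    gradedDepth K n ↥(extIdeal (K := K) (Fin.castLE h2.le) I ⊓ extIdeal (sndEmbed h2.le) J) =
      gradedDepth K n ↥(extIdeal (K := K) (Fin.castLE h2.le) I ⊔ extIdeal (sndEmbed h2.le) J)
        + 1 ∧
    gradedDepth K n ↥(extIdeal (K := K) (Fin.castLE h2.le) I ⊓ extIdeal (sndEmbed h2.le) J) =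
      gradedDepth K r ↥I + gradedDepth K (n - r) ↥J ∧
    gradedDepth K n ↥(Submodule.map (extIdeal (K := K) (Fin.castLE h2.le) I).mkQ
        ((extIdeal (Fin.castLE h2.le) I ⊔ extIdeal (sndEmbed h2.le) J :
          Ideal (MvPolynomial (Fin n) K)) : Submodule (MvPolynomial (Fin n) K)
            (MvPolynomial (Fin n) K))) =
      gradedDepth K n ↥(extIdeal (K := K) (Fin.castLE h2.le) I ⊔ extIdeal (sndEmbed h2.le) J) := by
  have hI := le_varIdeal_of_span_monomial hmI hI1
  have hJ := le_varIdeal_of_span_monomial hmJ hJ1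
  obtain ⟨d, hd⟩ := exists_hasDepth (supportDim_lt (MvPolynomial (Fin r) K ⧸ I))
    (varIdeal_smul_top_ne_top_of_le hI)
  obtain ⟨e, he⟩ := exists_hasDepth (supportDim_lt (MvPolynomial (Fin (n - r)) K ⧸ J))
    (varIdeal_smul_top_ne_top_of_le hJ)
  have hE := tensorEquivFin_tmul K h2.le
  have hm := span_range_X_eq K h2.le
  obtain ⟨einf⟩ := nonempty_externalTensor_inf hE I J
  obtain ⟨esup⟩ := nonempty_externalTensor_quotient_sup hE I J
  obtain ⟨emap⟩ := nonempty_externalTensor_map_mkQ hE I J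
  have hne : extIdeal (K := K) (Fin.castLE h2.le) I ⊔ extIdeal (sndEmbed h2.le) J ≠ ⊥ := by
    obtain ⟨x, hx, hx0⟩ := Submodule.exists_mem_ne_zero_of_ne_bot hI0
    refine Submodule.ne_bot_iff _ |>.mpr ⟨rename (Fin.castLE h2.le) x,
      Ideal.mem_sup_left (Ideal.mem_map_of_mem _ hx), ?_⟩
    rwa [Ne, map_eq_zero_iff _ (rename_injective _ (Fin.castLE_injective h2.le))]
  have hinf := (einf.hasDepth hm (hd.of_quotient hI0) (he.of_quotient hJ0)).gradedDepth_eq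
  have hsup := (HasDepth.of_quotient hne (esup.hasDepth hm hd he)).gradedDepth_eq
  have hmap := (emap.hasDepth hm hd (he.of_quotient hJ0)).gradedDepth_eq
  refine ⟨hinf.trans ?_, hinf.trans ?_, hmap.trans ?_⟩
  · rw [hsup]
    push_cast
    ring
  · rw [(hd.of_quotient hI0).gradedDepth_eq, (he.of_quotient hJ0).gradedDepth_eq]
    push_cast
    ring
  · rw [hsup, add_assoc]
end
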